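/- arXiv:0908.2461 — 6 statements merged into one kernel-verified Lean document; each statement's English description precedes it below -/
import Mathlib

section
/- dim Rad(proj_U S) − dim(S ∩ U) = dim Rad(proj_W S) − dim(S ∩ W), and dim proj_U S − dim Rad(proj_U S) = dim proj_W S − dim Rad(proj_W S). -/
open Module

/-- The projection of `S` onto `A` along the complement `C`: `(S + C) ⊓ A`. -/
def projAlong {k V : Type*} [Field k] [AddCommGroup V] [Module k V]
    (C A S : Submodule k V) : Submodule k V := (S ⊔ C) ⊓ A

/-- The radical of `T` with respect to `B`: `T ⊓ T^⊥`. -/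
def bilinRad {k V : Type*} [Field k] [AddCommGroup V] [Module k V]
    (B : LinearMap.BilinForm k V) (T : Submodule k V) : Submodule k V :=
  T ⊓ B.orthogonal T

section Projection

variable {k V : Type*} [Field k] [AddCommGroup V] [Module k V]

theorem finrank_projAlong_add_finrank_inf [FiniteDimensional k V] {U W : Submodule k V}
    (hUW : U ⊓ W = ⊥) (hUWtop : U ⊔ W = ⊤) (S : Submodule k V) :
    finrank k (projAlong W U S) + finrank k (S ⊓ W : Submodule k V) = finrank k S := by
  have h₁ := Submodule.finrank_sup_add_finrank_inf_eq (S ⊔ W) U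
  have h₂ := Submodule.finrank_sup_add_finrank_inf_eq S W
  have h₃ := Submodule.finrank_sup_add_finrank_inf_eq U W
  rw [sup_assoc, sup_comm W U, hUWtop, sup_top_eq] at h₁
  rw [hUW, hUWtop, finrank_bot] at h₃
  unfold projAlong
  omega

theorem projAlong_inf_sup {U W S T : Submodule k V} (hUW : U ⊓ W = ⊥)
    (hT : T ≤ projAlong W U S) : projAlong W U (S ⊓ (T ⊔ W)) = T := by
  have hTS : T ≤ S ⊔ W := hT.trans inf_le_left
  have hTU : T ≤ U := hT.trans inf_le_right
  have h₁ : S ⊓ (T ⊔ W) ⊔ W = T ⊔ W := by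
    rw [inf_comm, inf_sup_assoc_of_le S (le_sup_right : W ≤ T ⊔ W)]
    exact inf_eq_left.2 (sup_le hTS le_sup_right)
  rw [projAlong, h₁, sup_inf_assoc_of_le W hTU, inf_comm, hUW, sup_bot_eq]

theorem finrank_add_finrank_inf_of_le_projAlong [FiniteDimensional k V]
    {U W S T : Submodule k V} (hUW : U ⊓ W = ⊥) (hUWtop : U ⊔ W = ⊤)
    (hT : T ≤ projAlong W U S) :
    finrank k T + finrank k (S ⊓ W : Submodule k V)
      = finrank k (S ⊓ (T ⊔ W) : Submodule k V) := by
  have h := finrank_projAlong_add_finrank_inf hUW hUWtop (S ⊓ (T ⊔ W))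
  rwa [projAlong_inf_sup hUW hT, inf_assoc, inf_eq_right.2 (le_sup_right : W ≤ T ⊔ W)] at h

theorem inf_bilinRad_projAlong_sup_le {B : LinearMap.BilinForm k V} {U W S : Submodule k V}
    (horth : ∀ u ∈ U, ∀ w ∈ W, B u w = 0 ∧ B w u = 0)
    (hS : ∀ s ∈ S, ∀ s' ∈ S, B s s' = 0) :
    S ⊓ (bilinRad B (projAlong W U S) ⊔ W) ≤ S ⊓ (bilinRad B (projAlong U W S) ⊔ U) := by
  rintro x ⟨hxS, hx⟩
  refine ⟨hxS, ?_⟩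
  obtain ⟨r, ⟨⟨-, hrU⟩, hr⟩, w, hw, rfl⟩ := Submodule.mem_sup.1 hx
  refine Submodule.mem_sup.2 ⟨w, ⟨⟨?_, hw⟩, ?_⟩, r, hrU, add_comm w r⟩
  · exact Submodule.mem_sup.2 ⟨r + w, hxS, -r, U.neg_mem hrU, by abel⟩
  · rintro t ⟨ht, htW⟩
    obtain ⟨s, hs, u, hu, rfl⟩ := Submodule.mem_sup.1 ht
    have hmem : -u ∈ projAlong W U S :=
      ⟨Submodule.mem_sup.2 ⟨s, hs, -(s + u), W.neg_mem htW, by abel⟩, U.neg_mem hu⟩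
    have h₁ : B (-u) r = 0 := hr _ hmem
    have h₂ := hS s hs _ hxS
    have h₃ := (horth r hrU _ htW).2
    have h₄ := (horth u hu w hw).1
    change B (s + u) w = 0
    simp only [map_add, map_neg, LinearMap.add_apply, LinearMap.neg_apply] at *
    linear_combination h₂ - h₃ - h₁ + h₄

end Projection

/-- `dim Rad(proj_U S) − dim(S ∩ U) = dim Rad(proj_W S) − dim(S ∩ W)`
and `dim proj_U S − dim Rad(proj_U S) = dim proj_W S − dim Rad(proj_W S)`. -/
theorem stmt_2 (k : Type*) [Field k] (V : Type*) [AddCommGroup V] [Module k V]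
    [FiniteDimensional k V]
    (B : LinearMap.BilinForm k V)
    (U W : Submodule k V) (hUW : U ⊓ W = ⊥) (hUWtop : U ⊔ W = ⊤)
    (horth : ∀ u ∈ U, ∀ w ∈ W, B u w = 0 ∧ B w u = 0)
    (S : Submodule k V) (hS : ∀ s ∈ S, ∀ s' ∈ S, B s s' = 0) :
    (finrank k (bilinRad B (projAlong W U S)) : ℤ) - finrank k (S ⊓ U : Submodule k V)
      = (finrank k (bilinRad B (projAlong U W S)) : ℤ) - finrank k (S ⊓ W : Submodule k V) ∧
    (finrank k (projAlong W U S) : ℤ) - finrank k (bilinRad B (projAlong W U S))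
      = (finrank k (projAlong U W S) : ℤ) - finrank k (bilinRad B (projAlong U W S)) := by
  have horth' : ∀ w ∈ W, ∀ u ∈ U, B w u = 0 ∧ B u w = 0 :=
    fun w hw u hu => (horth u hu w hw).symm
  have hWU : W ⊓ U = ⊥ := by rwa [inf_comm]
  have hWUtop : W ⊔ U = ⊤ := by rwa [sup_comm]
  have hR := le_antisymm (inf_bilinRad_projAlong_sup_le horth hS)
    (inf_bilinRad_projAlong_sup_le horth' hS)
  have h₁ := finrank_projAlong_add_finrank_inf hUW hUWtop S
  have h₂ := finrank_projAlong_add_finrank_inf hWU hWUtop S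
  have h₃ := finrank_add_finrank_inf_of_le_projAlong
    (T := bilinRad B (projAlong W U S)) hUW hUWtop inf_le_left
  have h₄ := finrank_add_finrank_inf_of_le_projAlong
    (T := bilinRad B (projAlong U W S)) hWU hWUtop inf_le_left
  rw [hR] at h₃
  constructor <;> omega
end

section
/- posIdx(proj_U S) = negIdx(proj_W S) and negIdx(proj_U S) = posIdx(proj_W S). -/
open Module

/-- The maximal dimension of a subspace of `T` on which `B` is positive definite. -/
noncomputable def posIdx {V : Type*} [AddCommGroup V] [Module ℝ V]
    (B : LinearMap.BilinForm ℝ V) (T : Submodule ℝ V) : ℕ :=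
  sSup {n : ℕ | ∃ T' : Submodule ℝ V, T' ≤ T ∧ (∀ v ∈ T', v ≠ 0 → 0 < B v v) ∧
    Module.finrank ℝ T' = n}

/-- The maximal dimension of a subspace of `T` on which `B` is negative definite. -/
noncomputable def negIdx {V : Type*} [AddCommGroup V] [Module ℝ V]
    (B : LinearMap.BilinForm ℝ V) (T : Submodule ℝ V) : ℕ :=
  sSup {n : ℕ | ∃ T' : Submodule ℝ V, T' ≤ T ∧ (∀ v ∈ T', v ≠ 0 → B v v < 0) ∧
    Module.finrank ℝ T' = n}

/-- A subspace of the sum of two subspaces `S ⊔ W` admits a linear map into `S` which is the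
identity modulo `W`. -/
theorem exists_linearMap_sub_mem {k V : Type*} [Field k] [AddCommGroup V] [Module k V]
    {S W T : Submodule k V} (hT : T ≤ S ⊔ W) :
    ∃ h : T →ₗ[k] S, ∀ u : T, (h u : V) - u ∈ W := by
  let q : S →ₗ[k] V ⧸ W := W.mkQ ∘ₗ S.subtype
  have hq : ∀ u : T, (W.mkQ ∘ₗ T.subtype) u ∈ LinearMap.range q := by
    intro u
    obtain ⟨s, hs, w, hw, hsw⟩ := Submodule.mem_sup.1 (hT u.2)
    refine ⟨⟨s, hs⟩, (Submodule.Quotient.eq W).2 ?_⟩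
    have : s - (u : V) = -w := by rw [← hsw]; abel
    simpa [this] using hw
  obtain ⟨h, hh⟩ := Module.projective_lifting_property q.rangeRestrict
    (LinearMap.codRestrict _ (W.mkQ ∘ₗ T.subtype) hq) q.surjective_rangeRestrict
  exact ⟨h, fun u => (Submodule.Quotient.eq W).1
    (congrArg Subtype.val (LinearMap.congr_fun hh u))⟩

/-- A positive definite subspace of one projection of an isotropic subspace gives a negative
definite subspace of the same dimension in the other projection. -/
theorem exists_negDef_le_projAlong {V : Type*} [AddCommGroup V] [Module ℝ V]
    {B : LinearMap.BilinForm ℝ V} {U W S T : Submodule ℝ V}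
    (hUW : ∀ u ∈ U, ∀ w ∈ W, B u w = 0) (hWU : ∀ w ∈ W, ∀ u ∈ U, B w u = 0)
    (hS : ∀ s ∈ S, ∀ s' ∈ S, B s s' = 0)
    (hT : T ≤ projAlong W U S) (hpos : ∀ v ∈ T, v ≠ 0 → 0 < B v v) :
    ∃ T' ≤ projAlong U W S, (∀ v ∈ T', v ≠ 0 → B v v < 0) ∧ finrank ℝ T' = finrank ℝ T := by
  obtain ⟨h, hh⟩ := exists_linearMap_sub_mem (hT.trans inf_le_left)
  let f : T →ₗ[ℝ] V := S.subtype ∘ₗ h - T.subtype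
  have hU : ∀ u : T, (u : V) ∈ U := fun u => (hT u.2).2
  have hf : ∀ u : T, B (f u) (f u) = -B u u := by
    intro u
    have h0 := hS _ (h u).2 _ (h u).2
    have hsum : (h u : V) = u + f u := by simp [f]
    rw [hsum] at h0
    have h1 : B u (f u) = 0 := hUW _ (hU u) _ (hh u)
    have h2 : B (f u) u = 0 := hWU _ (hh u) _ (hU u)
    simp only [map_add, LinearMap.add_apply, h1, h2] at h0
    linarith
  have hinj : Function.Injective f := by
    refine (injective_iff_map_eq_zero f).2 fun u hu => ?_
    by_contra hne
    have hp := hpos u u.2 (by simpa using hne)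
    have := hf u
    rw [hu, map_zero] at this
    linarith
  refine ⟨LinearMap.range f, ?_, ?_, LinearMap.finrank_range_of_inj hinj⟩
  · rintro _ ⟨u, rfl⟩
    exact ⟨sub_mem (Submodule.mem_sup_left (h u).2) (Submodule.mem_sup_right (hU u)), hh u⟩
  · rintro _ ⟨u, rfl⟩ hne
    rw [hf u, neg_lt_zero]
    refine hpos u u.2 fun hu => hne ?_
    rw [show u = 0 from Subtype.ext hu, map_zero]

theorem posIdx_projAlong_eq_negIdx {V : Type*} [AddCommGroup V] [Module ℝ V]
    {B : LinearMap.BilinForm ℝ V} {U W S : Submodule ℝ V}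
    (hUW : ∀ u ∈ U, ∀ w ∈ W, B u w = 0) (hWU : ∀ w ∈ W, ∀ u ∈ U, B w u = 0)
    (hS : ∀ s ∈ S, ∀ s' ∈ S, B s s' = 0) :
    posIdx B (projAlong W U S) = negIdx B (projAlong U W S) := by
  unfold posIdx negIdx
  congr 1
  ext n
  constructor
  · rintro ⟨T, hT, hpos, rfl⟩
    exact exists_negDef_le_projAlong hUW hWU hS hT hpos
  · rintro ⟨T, hT, hneg, rfl⟩
    simpa using exists_negDef_le_projAlong (B := -B) (by simpa using hWU) (by simpa using hUW)
      (by simpa using hS) hT (by simpa using hneg)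

/-- `posIdx(proj_U S) = negIdx(proj_W S)` and
`negIdx(proj_U S) = posIdx(proj_W S)`. -/
theorem stmt_3 (V : Type*) [AddCommGroup V] [Module ℝ V] [FiniteDimensional ℝ V]
    (B : LinearMap.BilinForm ℝ V)
    (hBsymm : ∀ x y : V, B x y = B y x)
    (hBnd : ∀ x : V, (∀ y : V, B x y = 0) → x = 0)
    (U W : Submodule ℝ V) (hUW : U ⊓ W = ⊥) (hUWtop : U ⊔ W = ⊤)
    (horth : ∀ u ∈ U, ∀ w ∈ W, B u w = 0)
    (S : Submodule ℝ V) (hS : ∀ s ∈ S, ∀ s' ∈ S, B s s' = 0) :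
    posIdx B (projAlong W U S) = negIdx B (projAlong U W S) ∧
    negIdx B (projAlong W U S) = posIdx B (projAlong U W S) := by
  have horth' : ∀ w ∈ W, ∀ u ∈ U, B w u = 0 := fun w hw u hu =>
    (hBsymm w u).trans (horth u hu w hw)
  exact ⟨posIdx_projAlong_eq_negIdx horth horth' hS,
    (posIdx_projAlong_eq_negIdx horth' horth hS).symm⟩
end

section
/- The following four inequalities hold: dim Rad(proj_U S) + posIdx(proj_U S) ≤ posIdx(U); dim Rad(proj_U S) + negIdx(proj_U S) ≤ negIdx(U); dim Rad(proj_W S) + posIdx(proj_W S) ≤ posIdx(W); and dim Rad(proj_W S) + negIdx(proj_W S) ≤ negIdx(W). -/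
open Module

section Index

variable {V : Type*} [AddCommGroup V] [Module ℝ V]

theorem posIdx_neg (B : LinearMap.BilinForm ℝ V) (T : Submodule ℝ V) :
    posIdx (-B) T = negIdx B T := by
  simp [posIdx, negIdx]

theorem bilinRad_neg (B : LinearMap.BilinForm ℝ V) (T : Submodule ℝ V) :
    bilinRad (-B) T = bilinRad B T := by
  ext x
  simp [bilinRad, LinearMap.BilinForm.mem_orthogonal_iff]

variable [FiniteDimensional ℝ V]

theorem bddAbove_finrank_posDef (B : LinearMap.BilinForm ℝ V) (T : Submodule ℝ V) :
    BddAbove {n : ℕ | ∃ T' : Submodule ℝ V, T' ≤ T ∧ (∀ v ∈ T', v ≠ 0 → 0 < B v v) ∧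
      finrank ℝ T' = n} := by
  refine ⟨finrank ℝ V, ?_⟩
  rintro n ⟨T', -, -, rfl⟩
  exact T'.finrank_le

theorem finrank_le_posIdx (B : LinearMap.BilinForm ℝ V) {T Q : Submodule ℝ V} (hQT : Q ≤ T)
    (hQ : ∀ v ∈ Q, v ≠ 0 → 0 < B v v) : finrank ℝ Q ≤ posIdx B T :=
  le_csSup (bddAbove_finrank_posDef B T) ⟨Q, hQT, hQ, rfl⟩

theorem exists_finrank_eq_posIdx (B : LinearMap.BilinForm ℝ V) (T : Submodule ℝ V) :
    ∃ Q ≤ T, (∀ v ∈ Q, v ≠ 0 → 0 < B v v) ∧ finrank ℝ Q = posIdx B T := by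
  have hbot : ∀ v ∈ (⊥ : Submodule ℝ V), v ≠ 0 → 0 < B v v :=
    fun v hv hv0 => absurd ((Submodule.mem_bot ℝ).1 hv) hv0
  exact Nat.sSup_mem (s := {n : ℕ | ∃ T' : Submodule ℝ V, T' ≤ T ∧
    (∀ v ∈ T', v ≠ 0 → 0 < B v v) ∧ finrank ℝ T' = n})
    ⟨0, ⊥, bot_le, hbot, finrank_bot ℝ V⟩ (bddAbove_finrank_posDef B T)

/-- On the orthogonal complement in `U` of a positive definite subspace of maximal dimension, the
form is negative semidefinite. -/
theorem apply_self_nonpos_of_finrank_eq_posIdx {B : LinearMap.BilinForm ℝ V}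
    (hB : ∀ x y, B x y = B y x) {U Q : Submodule ℝ V} (hQU : Q ≤ U)
    (hQ : ∀ v ∈ Q, v ≠ 0 → 0 < B v v) (hmax : finrank ℝ Q = posIdx B U) {z : V} (hz : z ∈ U)
    (hzQ : ∀ q ∈ Q, B z q = 0) : B z z ≤ 0 := by
  by_contra! hpos
  have hlt : Q < Q ⊔ ℝ ∙ z := by
    refine left_lt_sup.2 fun h => hpos.ne' (hzQ z (h (Submodule.mem_span_singleton_self z)))
  have hle : finrank ℝ ↥(Q ⊔ ℝ ∙ z) ≤ posIdx B U := by
    refine finrank_le_posIdx B (sup_le hQU ((Submodule.span_singleton_le_iff_mem z U).2 hz)) ?_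
    intro v hv hv0
    obtain ⟨q, hq, y, hy, rfl⟩ := Submodule.mem_sup.1 hv
    obtain ⟨c, rfl⟩ := Submodule.mem_span_singleton.1 hy
    have hval : B (q + c • z) (q + c • z) = B q q + c ^ 2 * B z z := by
      simp [hB q z, hzQ q hq]
      ring
    rw [hval]
    by_cases hq0 : q = 0
    · subst hq0
      have hc : c ≠ 0 := by
        rintro rfl
        simp at hv0
      simp only [map_zero, zero_add]
      positivity
    · have := hQ q hq hq0
      positivity
  have := Submodule.finrank_lt_finrank_of_lt hlt
  omega

/-- Every vector is congruent, modulo a positive definite subspace `Q`, to one orthogonal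
to `Q`. -/
theorem exists_sub_orthogonal_of_posDef {B : LinearMap.BilinForm ℝ V} {Q : Submodule ℝ V}
    (hQ : ∀ v ∈ Q, v ≠ 0 → 0 < B v v) (y : V) : ∃ p ∈ Q, ∀ q ∈ Q, B (y - p) q = 0 := by
  have hinj : Function.Injective (B.domRestrict₁₂ Q Q) := by
    rw [injective_iff_map_eq_zero]
    intro p hp
    by_contra hp0
    have h : B p p = 0 := LinearMap.congr_fun hp p
    exact (hQ p p.2 (by simpa using hp0)).ne' h
  have hsurj := (LinearMap.injective_iff_surjective_of_finrank_eq_finrank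
    (Subspace.dual_finrank_eq (K := ℝ) (V := Q)).symm).1 hinj
  obtain ⟨p, hp⟩ := hsurj ((B y).domRestrict Q)
  refine ⟨p, p.2, fun q hq => ?_⟩
  have h : B p q = B y q := LinearMap.congr_fun hp ⟨q, hq⟩
  simp [h]

theorem finrank_le_posIdx_of_posSemidef {B : LinearMap.BilinForm ℝ V}
    (hB : ∀ x y, B x y = B y x) {U X : Submodule ℝ V}
    (hU : ∀ x ∈ U, (∀ y ∈ U, B x y = 0) → x = 0) (hXU : X ≤ U) (hX : ∀ x ∈ X, 0 ≤ B x x) :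
    finrank ℝ X ≤ posIdx B U := by
  obtain ⟨Q, hQU, hQ, hmax⟩ := exists_finrank_eq_posIdx B U
  rw [← hmax, ← Subspace.dual_finrank_eq (K := ℝ) (V := Q)]
  refine LinearMap.finrank_le_finrank_of_injective (f := B.domRestrict₁₂ X Q) ?_
  rw [injective_iff_map_eq_zero]
  rintro ⟨x, hx⟩ hxQ
  replace hxQ : ∀ q ∈ Q, B x q = 0 := fun q hq => LinearMap.congr_fun hxQ ⟨q, hq⟩
  have hxx : B x x = 0 :=
    (apply_self_nonpos_of_finrank_eq_posIdx hB hQU hQ hmax (hXU hx) hxQ).antisymm (hX x hx)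
  refine Subtype.ext (hU x (hXU hx) fun y hy => ?_)
  obtain ⟨p, hp, hpQ⟩ := exists_sub_orthogonal_of_posDef hQ y
  set z := y - p with hz
  have hxz : B x z = B x y := by simp [hz, hxQ p hp]
  by_contra hxy
  have hnonpos (t : ℝ) : B (t • x + z) (t • x + z) ≤ 0 := by
    refine apply_self_nonpos_of_finrank_eq_posIdx hB hQU hQ hmax
      (U.add_mem (U.smul_mem t (hXU hx)) (U.sub_mem hy (hQU hp))) fun q hq => ?_
    simp [hxQ q hq, hpQ q hq]
  have hval (t : ℝ) : B (t • x + z) (t • x + z) = 2 * t * B x y + B z z := by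
    simp only [map_add, map_smul, LinearMap.add_apply, LinearMap.smul_apply, smul_eq_mul,
      hB z x, hxx, hxz]
    ring
  have h := hnonpos ((1 - B z z) / (2 * B x y))
  rw [hval] at h
  field_simp at h
  linarith

theorem finrank_bilinRad_add_posIdx_le {B : LinearMap.BilinForm ℝ V}
    (hB : ∀ x y, B x y = B y x) {U T : Submodule ℝ V}
    (hU : ∀ x ∈ U, (∀ y ∈ U, B x y = 0) → x = 0) (hTU : T ≤ U) :
    finrank ℝ (bilinRad B T) + posIdx B T ≤ posIdx B U := by
  obtain ⟨P, hPT, hP, hmax⟩ := exists_finrank_eq_posIdx B T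
  have hrad : ∀ r ∈ bilinRad B T, ∀ t ∈ T, B t r = 0 := fun r hr => hr.2
  have hdisj : bilinRad B T ⊓ P = ⊥ := by
    refine (Submodule.eq_bot_iff _).2 fun x hx => ?_
    by_contra hx0
    exact (hP x hx.2 hx0).ne' (hrad x hx.1 x (hPT hx.2))
  have hdim := Submodule.finrank_sup_add_finrank_inf_eq (bilinRad B T) P
  rw [hdisj, finrank_bot, add_zero, hmax] at hdim
  rw [← hdim]
  refine finrank_le_posIdx_of_posSemidef hB hU
    (sup_le (inf_le_left.trans hTU) (hPT.trans hTU)) fun x hx => ?_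
  obtain ⟨r, hr, p, hp, rfl⟩ := Submodule.mem_sup.1 hx
  have hval : B (r + p) (r + p) = B p p := by
    simp [hB r p, hrad r hr p (hPT hp), hrad r hr r hr.1]
  rw [hval]
  by_cases hp0 : p = 0
  · simp [hp0]
  · exact (hP p hp hp0).le

theorem finrank_bilinRad_add_negIdx_le {B : LinearMap.BilinForm ℝ V}
    (hB : ∀ x y, B x y = B y x) {U T : Submodule ℝ V}
    (hU : ∀ x ∈ U, (∀ y ∈ U, B x y = 0) → x = 0) (hTU : T ≤ U) :
    finrank ℝ (bilinRad B T) + negIdx B T ≤ negIdx B U := by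
  rw [← bilinRad_neg, ← posIdx_neg, ← posIdx_neg]
  exact finrank_bilinRad_add_posIdx_le (by simpa using hB) (by simpa using hU) hTU

end Index

/-- An orthogonal direct summand of a nondegenerate space is nondegenerate. -/
theorem eq_zero_of_forall_mem_summand {k V : Type*} [Field k] [AddCommGroup V] [Module k V]
    {B : LinearMap.BilinForm k V} (hB : ∀ x : V, (∀ y : V, B x y = 0) → x = 0)
    {U W : Submodule k V} (hUW : U ⊔ W = ⊤) (horth : ∀ u ∈ U, ∀ w ∈ W, B u w = 0) :
    ∀ x ∈ U, (∀ y ∈ U, B x y = 0) → x = 0 := by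
  intro x hx hxU
  refine hB x fun y => ?_
  obtain ⟨u, hu, w, hw, rfl⟩ := Submodule.mem_sup.1 (hUW ▸ Submodule.mem_top : y ∈ U ⊔ W)
  simp [hxU u hu, horth x hx w hw]

/-- the four inequalities relating the radical and the signatures of
the projections with the signatures of `U` and `W`. -/
theorem stmt_4 (V : Type*) [AddCommGroup V] [Module ℝ V] [FiniteDimensional ℝ V]
    (B : LinearMap.BilinForm ℝ V)
    (hBsymm : ∀ x y : V, B x y = B y x)
    (hBnd : ∀ x : V, (∀ y : V, B x y = 0) → x = 0)
    (U W : Submodule ℝ V) (hUW : U ⊓ W = ⊥) (hUWtop : U ⊔ W = ⊤)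
    (horth : ∀ u ∈ U, ∀ w ∈ W, B u w = 0)
    (S : Submodule ℝ V) (hS : ∀ s ∈ S, ∀ s' ∈ S, B s s' = 0) :
    finrank ℝ (bilinRad B (projAlong W U S)) + posIdx B (projAlong W U S) ≤ posIdx B U ∧
    finrank ℝ (bilinRad B (projAlong W U S)) + negIdx B (projAlong W U S) ≤ negIdx B U ∧
    finrank ℝ (bilinRad B (projAlong U W S)) + posIdx B (projAlong U W S) ≤ posIdx B W ∧
    finrank ℝ (bilinRad B (projAlong U W S)) + negIdx B (projAlong U W S) ≤ negIdx B W := by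
  have hU := eq_zero_of_forall_mem_summand hBnd hUWtop horth
  have hW := eq_zero_of_forall_mem_summand hBnd (sup_comm U W ▸ hUWtop)
    fun w hw u hu => (hBsymm w u).trans (horth u hu w hw)
  exact ⟨finrank_bilinRad_add_posIdx_le hBsymm hU inf_le_right,
    finrank_bilinRad_add_negIdx_le hBsymm hU inf_le_right,
    finrank_bilinRad_add_posIdx_le hBsymm hW inf_le_right,
    finrank_bilinRad_add_negIdx_le hBsymm hW inf_le_right⟩
end

section
/- Let S and S' be isotropic subspaces of V such that dim(S ∩ U) = dim(S' ∩ U), dim(S ∩ W) = dim(S' ∩ W), dim Rad(proj_U S) = dim Rad(proj_U S'), posIdx(proj_U S) = posIdx(proj_U S'), and negIdx(proj_U S) = negIdx(proj_U S'). Then there exists a linear automorphism g of V with B(g x, g y) = B(x, y) for all x, y ∈ V, g(U) = U, g(W) = W, and g(S) = S'. -/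
open Module

section Witt

variable {V : Type*} [AddCommGroup V] [Module ℝ V] [FiniteDimensional ℝ V]
  {B : LinearMap.BilinForm ℝ V}

/-- For a nondegenerate form, a vector outside `T` is separated from `T` by a vector
orthogonal to `T`. -/
theorem exists_orthogonal_apply_eq_one (hBnd : ∀ x : V, (∀ y : V, B x y = 0) → x = 0)
    {T : Submodule ℝ V} {x : V} (hx : x ∉ T) :
    ∃ w : V, (∀ t ∈ T, B w t = 0) ∧ B w x = 1 := by
  obtain ⟨f, hfx, hfT⟩ := Submodule.exists_le_ker_of_notMem hx
  have hinj : Function.Injective B := by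
    rw [injective_iff_map_eq_zero]
    intro a ha
    exact hBnd a fun y => by simp [ha]
  have hsurj : Function.Surjective B :=
    (LinearMap.injective_iff_surjective_of_finrank_eq_finrank
      (Subspace.dual_finrank_eq (K := ℝ) (V := V)).symm).1 hinj
  obtain ⟨w, hw⟩ := hsurj f
  refine ⟨(f x)⁻¹ • w, fun t ht => ?_, ?_⟩
  · have : f t = 0 := hfT ht
    simp [hw, this]
  · simp [hw, hfx]

/-- A linear isometry carrying `x` to `y` and fixing a subspace pairing equally with both. -/
theorem exists_isometry_fixing_map_eq (hBsymm : ∀ x y : V, B x y = B y x)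
    (hBnd : ∀ x : V, (∀ y : V, B x y = 0) → x = 0)
    {T : Submodule ℝ V} {x y : V} (hx : x ∉ T) (hy : y ∉ T)
    (hT : ∀ t ∈ T, B x t = B y t) (hxy : B x x = B y y) :
    ∃ h : V →ₗ[ℝ] V, (∀ u v : V, B (h u) (h v) = B u v) ∧ (∀ t ∈ T, h t = t) ∧ h x = y := by
  obtain ⟨z, rfl⟩ : ∃ z, y = x - z := ⟨x - y, by abel⟩
  have hzT : ∀ t ∈ T, B z t = 0 := fun t ht => by
    have := hT t ht
    simp only [map_sub, LinearMap.sub_apply] at this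
    linarith
  have hzx : 2 * B z x = B z z := by
    simp only [map_sub, LinearMap.sub_apply] at hxy
    linarith [hBsymm x z]
  by_cases hzz : B z z = 0
  · have hzx0 : B z x = 0 := by linarith
    by_cases hxs : x ∈ T ⊔ Submodule.span ℝ {z}
    · obtain ⟨t, ht, z', hz', hsum⟩ := Submodule.mem_sup.1 hxs
      obtain ⟨c, rfl⟩ := Submodule.mem_span_singleton.1 hz'
      subst hsum
      have hc : c ≠ 0 := by
        rintro rfl
        exact hx (by simpa using ht)
      have hc1 : c - 1 ≠ 0 := by
        intro h
        obtain rfl : c = 1 := by linarith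
        exact hy (by simpa using ht)
      have hzT' : z ∉ T := fun h => hx (T.add_mem ht (T.smul_mem c h))
      obtain ⟨w, hwT, hwz⟩ := exists_orthogonal_apply_eq_one hBnd hzT'
      obtain ⟨w', hw'T, hw'z, hw'w'⟩ : ∃ w' : V, (∀ t ∈ T, B w' t = 0) ∧ B w' z = 1 ∧
          B w' w' = 0 := by
        refine ⟨w - (B w w / 2) • z, fun t ht => ?_, ?_, ?_⟩
        · simp [hwT t ht, hzT t ht]
        · simp [hwz, hzz]
        · simp only [map_sub, map_smul, LinearMap.sub_apply, LinearMap.smul_apply, smul_eq_mul,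
            hBsymm z w, hwz, hzz]
          ring
      refine ⟨LinearMap.id + (B w').smulRight (((c - 1) / c - 1) • z)
        + (B z).smulRight ((c / (c - 1) - 1) • w'), fun u v => ?_, fun t ht => ?_, ?_⟩
      · simp only [LinearMap.add_apply, LinearMap.id_apply, LinearMap.smulRight_apply, map_add,
          map_smul, LinearMap.smul_apply, smul_eq_mul, hBsymm z w', hw'z, hw'w', hzz,
          hBsymm u z, hBsymm u w']
        field_simp
        ring
      · simp [hw'T t ht, hzT t ht]
      · simp only [LinearMap.add_apply, LinearMap.id_apply, LinearMap.smulRight_apply, map_add,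
          map_smul, hw'T t ht, hzT t ht, hw'z, hzz]
        match_scalars <;> field_simp <;> ring
    · obtain ⟨w, hw, hwx⟩ := exists_orthogonal_apply_eq_one hBnd hxs
      have hwz : B w z = 0 :=
        hw z (Submodule.mem_sup_right (Submodule.mem_span_singleton_self z))
      refine ⟨LinearMap.id + (B z).smulRight (w - (B w w / 2) • z) - (B w).smulRight z,
        fun u v => ?_, fun t ht => ?_, ?_⟩
      · simp only [LinearMap.add_apply, LinearMap.sub_apply, LinearMap.id_apply,
          LinearMap.smulRight_apply, map_add, map_sub,
          map_smul, LinearMap.smul_apply, smul_eq_mul, hBsymm z w, hwz, hzz,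
          hBsymm u z, hBsymm u w]
        ring
      · simp [hw t (Submodule.mem_sup_left ht), hzT t ht]
      · simp [hzx0, hwx]
  · refine ⟨LinearMap.id - (B z).smulRight ((2 / B z z) • z), fun u v => ?_, fun t ht => ?_, ?_⟩
    · simp only [LinearMap.sub_apply, LinearMap.id_apply, LinearMap.smulRight_apply, map_sub,
        map_smul, LinearMap.smul_apply, smul_eq_mul, hBsymm u z]
      field_simp
      ring
    · simp [hzT t ht]
    · have : B z x * (2 / B z z) = 1 := by
        field_simp
        linarith
      simp [smul_smul, this]

/-- Witt's extension theorem for finite families in a subspace `U` orthogonal to `W`; the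
isometry fixes `W` pointwise. -/
theorem exists_isometry_extending (hBsymm : ∀ x y : V, B x y = B y x)
    (hBnd : ∀ x : V, (∀ y : V, B x y = 0) → x = 0)
    {U W : Submodule ℝ V} (hUW : Disjoint U W) (horth : ∀ u ∈ U, ∀ w ∈ W, B u w = 0)
    {ι : Type*} [Finite ι] {x y : ι → V} (hxU : ∀ i, x i ∈ U) (hyU : ∀ i, y i ∈ U)
    (hx : LinearIndependent ℝ x) (hy : LinearIndependent ℝ y)
    (hxy : ∀ i j, B (x i) (x j) = B (y i) (y j)) :
    ∃ g : V ≃ₗ[ℝ] V, (∀ u v : V, B (g u) (g v) = B u v) ∧ (∀ w ∈ W, g w = w) ∧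
      ∀ i, g (x i) = y i := by
  classical
  have key : ∀ x : ι → V, (∀ i, x i ∈ U) → LinearIndependent ℝ x → ∀ s : Set ι, ∀ j ∉ s,
      x j ∉ Submodule.span ℝ (x '' s) ⊔ W := by
    intro x hxU hx s j hj hmem
    obtain ⟨t, ht, w, hw, hsum⟩ := Submodule.mem_sup.1 hmem
    have htU : t ∈ U :=
      Submodule.span_le.2 (by rintro _ ⟨i, -, rfl⟩; exact hxU i) ht
    have hwU : w ∈ U := by
      have : w = x j - t := by rw [← hsum]; abel
      rw [this]
      exact U.sub_mem (hxU j) htU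
    have hw0 : w = 0 := Submodule.disjoint_def.1 hUW w hwU hw
    rw [hw0, add_zero] at hsum
    exact hx.notMem_span_image hj (hsum ▸ ht)
  have toEquiv : ∀ h : V →ₗ[ℝ] V, (∀ u v : V, B (h u) (h v) = B u v) →
      ∃ g : V ≃ₗ[ℝ] V, ∀ v, g v = h v := by
    intro h hh
    have hinj : Function.Injective h := by
      rw [injective_iff_map_eq_zero]
      intro a ha
      exact hBnd a fun v => by rw [← hh, ha]; simp
    exact ⟨LinearEquiv.ofInjectiveEndo h hinj, fun v => rfl⟩
  have main : ∀ s : Finset ι, ∃ g : V ≃ₗ[ℝ] V, (∀ u v : V, B (g u) (g v) = B u v) ∧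
      (∀ w ∈ W, g w = w) ∧ ∀ i ∈ s, g (x i) = y i := by
    intro s
    induction s using Finset.induction_on with
    | empty => exact ⟨LinearEquiv.refl ℝ V, by simp, by simp, by simp⟩
    | insert j s hj ih =>
      obtain ⟨g, hg, hgW, hgs⟩ := ih
      obtain ⟨h, hh, hhT, hhx⟩ := exists_isometry_fixing_map_eq hBsymm hBnd
        (T := Submodule.span ℝ (y '' s) ⊔ W) (x := g (x j)) (y := y j)
        (fun hmem => by
          apply key x hxU hx s j (by simpa using hj)
          have hle : Submodule.span ℝ (y '' s) ⊔ W ≤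
              (Submodule.span ℝ (x '' s) ⊔ W).map (g : V →ₗ[ℝ] V) := by
            refine sup_le (Submodule.span_le.2 ?_) fun w hw => ?_
            · rintro _ ⟨i, hi, rfl⟩
              exact ⟨x i, Submodule.mem_sup_left (Submodule.subset_span ⟨i, hi, rfl⟩),
                hgs i hi⟩
            · exact ⟨w, Submodule.mem_sup_right hw, hgW w hw⟩
          obtain ⟨v, hv, hve⟩ := hle hmem
          rwa [← g.injective hve])
        (key y hyU hy s j (by simpa using hj))
        (fun t ht => by
          have hle : Submodule.span ℝ (y '' s) ⊔ W ≤ LinearMap.ker (B (g (x j)) - B (y j)) := by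
            refine sup_le (Submodule.span_le.2 ?_) fun w hw => ?_
            · rintro _ ⟨i, hi, rfl⟩
              have h1 : B (g (x j)) (y i) = B (y j) (y i) := by rw [← hgs i hi, hg, hgs i hi, hxy]
              simp [h1]
            · have h1 : B (g (x j)) w = 0 := by
                rw [← hgW w hw, hg]
                exact horth _ (hxU j) _ hw
              simp [h1, horth _ (hyU j) _ hw]
          have := hle ht
          simpa [sub_eq_zero] using this)
        (by rw [hg, hxy])
      obtain ⟨k, hk⟩ := toEquiv h hh
      refine ⟨g.trans k, fun u v => ?_, fun w hw => ?_, fun i hi => ?_⟩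
      · simp [hk, hh, hg]
      · simp [hk, hgW w hw, hhT w (Submodule.mem_sup_right hw)]
      · rcases Finset.mem_insert.1 hi with rfl | hi
        · simp [hk, hhx]
        · simp [hk, hgs i hi,
            hhT _ (Submodule.mem_sup_left (Submodule.subset_span ⟨i, hi, rfl⟩))]
  have := Fintype.ofFinite ι
  obtain ⟨g, hg, hgW, hgs⟩ := main Finset.univ
  exact ⟨g, hg, hgW, fun i => hgs i (Finset.mem_univ i)⟩

end Witt

section Signature

variable {V : Type*} [AddCommGroup V] [Module ℝ V]
  {B : LinearMap.BilinForm ℝ V} {ι : Type*} [Fintype ι] {f : ι → V} {ε : ι → SignType}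

theorem bilin_sum_smul_apply_of_orthogonal (hdiag : ∀ i, B (f i) (f i) = ε i)
    (hoff : ∀ i j, i ≠ j → B (f i) (f j) = 0) (c : ι → ℝ) (j : ι) :
    B (∑ i, c i • f i) (f j) = c j * ε j := by
  simp only [map_sum, LinearMap.sum_apply, map_smul, LinearMap.smul_apply, smul_eq_mul]
  rw [Finset.sum_eq_single j (fun i _ hij => by rw [hoff i j hij, mul_zero]) (by simp), hdiag]

theorem bilin_sum_smul_self_of_orthogonal (hdiag : ∀ i, B (f i) (f i) = ε i)
    (hoff : ∀ i j, i ≠ j → B (f i) (f j) = 0) (c : ι → ℝ) :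
    B (∑ i, c i • f i) (∑ i, c i • f i) = ∑ i, c i * (c i * ε i) := by
  rw [map_sum (B (∑ i, c i • f i))]
  simp only [map_smul, smul_eq_mul, bilin_sum_smul_apply_of_orthogonal hdiag hoff]

/-- The positive index of the span of an orthogonal family with values in `{-1, 0, 1}`. -/
theorem posIdx_span_of_orthogonal [FiniteDimensional ℝ V] (hf : LinearIndependent ℝ f)
    (hdiag : ∀ i, B (f i) (f i) = ε i) (hoff : ∀ i j, i ≠ j → B (f i) (f j) = 0) :
    posIdx B (Submodule.span ℝ (Set.range f)) = Fintype.card {i // ε i = 1} := by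
  classical
  refine IsGreatest.csSup_eq ⟨?_, ?_⟩
  · refine ⟨Submodule.span ℝ (Set.range fun i : {i // ε i = 1} => f i), ?_, ?_, ?_⟩
    · apply Submodule.span_mono
      rintro _ ⟨i, rfl⟩
      exact ⟨i, rfl⟩
    · intro v hv hv0
      obtain ⟨c, rfl⟩ := (Submodule.mem_span_range_iff_exists_fun ℝ).1 hv
      rw [bilin_sum_smul_self_of_orthogonal (f := fun i : {i // ε i = 1} => f i)
        (ε := fun i : {i // ε i = 1} => ε i) (fun i => hdiag i)
        (fun i j hij => hoff i j fun h => hij (Subtype.ext h))]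
      obtain ⟨i, hi⟩ : ∃ i, c i ≠ 0 := by
        by_contra! h
        exact hv0 (by simp [h])
      refine Finset.sum_pos' (fun j _ => ?_) ⟨i, Finset.mem_univ i, ?_⟩
      · simpa [j.2] using mul_self_nonneg (c j)
      · simpa [i.2] using hi
    · exact finrank_span_eq_card (hf.comp _ Subtype.val_injective)
  · rintro _ ⟨T', hT', hpos, rfl⟩
    set N := Submodule.span ℝ (Set.range fun i : {i // ¬ ε i = 1} => f i) with hN
    have hNle : N ≤ Submodule.span ℝ (Set.range f) := by
      apply Submodule.span_mono
      rintro _ ⟨i, rfl⟩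
      exact ⟨i, rfl⟩
    have hNcard : finrank ℝ N = Fintype.card {i // ¬ ε i = 1} :=
      finrank_span_eq_card (hf.comp _ Subtype.val_injective)
    have hdisj : T' ⊓ N = ⊥ := by
      rw [eq_bot_iff]
      rintro v ⟨hvT, hvN⟩
      by_contra hv0
      have hvpos := hpos v hvT hv0
      obtain ⟨c, rfl⟩ := (Submodule.mem_span_range_iff_exists_fun ℝ).1 hvN
      rw [bilin_sum_smul_self_of_orthogonal (f := fun i : {i // ¬ ε i = 1} => f i)
        (ε := fun i : {i // ¬ ε i = 1} => ε i) (fun i => hdiag i)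
        (fun i j hij => hoff i j fun h => hij (Subtype.ext h))] at hvpos
      refine absurd hvpos (not_lt.2 (Finset.sum_nonpos fun i _ => ?_))
      have hle : ((ε i : SignType) : ℝ) ≤ 0 := by
        have := i.2
        rcases h : ε i with _ | _ | _
        · simp
        · simp
        · exact absurd h this
      rw [← mul_assoc]
      exact mul_nonpos_of_nonneg_of_nonpos (mul_self_nonneg _) hle
    have h1 := Submodule.finrank_sup_add_finrank_inf_eq T' N
    have h2 : finrank ℝ (T' ⊔ N : Submodule ℝ V) ≤ Fintype.card ι := by
      rw [← finrank_span_eq_card hf]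
      exact Submodule.finrank_mono (sup_le hT' hNle)
    have h3 := Fintype.card_subtype_compl fun i => ε i = 1
    have h4 := Fintype.card_subtype_le fun i => ε i = 1
    rw [hdisj, finrank_bot] at h1
    omega

/-- The negative index of the span of an orthogonal family with values in `{-1, 0, 1}`. -/
theorem negIdx_span_of_orthogonal [FiniteDimensional ℝ V] (hf : LinearIndependent ℝ f)
    (hdiag : ∀ i, B (f i) (f i) = ε i) (hoff : ∀ i j, i ≠ j → B (f i) (f j) = 0) :
    negIdx B (Submodule.span ℝ (Set.range f)) = Fintype.card {i // ε i = -1} := by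
  have h := posIdx_span_of_orthogonal (B := -B) (ε := fun i => -ε i) hf
    (fun i => by simp [hdiag]) (fun i j hij => by simp [hoff i j hij])
  have h' : negIdx B (Submodule.span ℝ (Set.range f)) =
      posIdx (-B) (Submodule.span ℝ (Set.range f)) := by
    simp [negIdx, posIdx]
  rw [h', h]
  exact Fintype.card_congr (Equiv.subtypeEquivRight fun i => neg_eq_iff_eq_neg)

/-- The dimension of the radical of the span of an orthogonal family with values in
`{-1, 0, 1}`. -/
theorem finrank_bilinRad_span_of_orthogonal (hf : LinearIndependent ℝ f)
    (hdiag : ∀ i, B (f i) (f i) = ε i) (hoff : ∀ i j, i ≠ j → B (f i) (f j) = 0)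
    (hBsymm : ∀ x y : V, B x y = B y x) :
    finrank ℝ (bilinRad B (Submodule.span ℝ (Set.range f))) =
      Fintype.card {i // ε i = 0} := by
  classical
  have hrad : bilinRad B (Submodule.span ℝ (Set.range f)) =
      Submodule.span ℝ (Set.range fun i : {i // ε i = 0} => f i) := by
    apply le_antisymm
    · rintro v ⟨hv, hvo⟩
      obtain ⟨c, rfl⟩ := (Submodule.mem_span_range_iff_exists_fun ℝ).1 hv
      refine Submodule.sum_mem _ fun i _ => ?_
      by_cases hi : ε i = 0
      · exact Submodule.smul_mem _ _ (Submodule.subset_span ⟨⟨i, hi⟩, rfl⟩)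
      · have h0 : B (f i) (∑ i, c i • f i) = 0 :=
          LinearMap.BilinForm.mem_orthogonal_iff.1 hvo (f i) (Submodule.subset_span ⟨i, rfl⟩)
        rw [hBsymm, bilin_sum_smul_apply_of_orthogonal hdiag hoff] at h0
        have hc : c i = 0 := by
          rcases h : ε i with _ | _ | _
          · exact absurd h hi
          · simpa [h] using h0
          · simpa [h] using h0
        simp [hc]
    · refine Submodule.span_le.2 ?_
      rintro _ ⟨⟨i, hi⟩, rfl⟩
      refine ⟨Submodule.subset_span ⟨i, rfl⟩,
        LinearMap.BilinForm.mem_orthogonal_iff.2 fun v hv => ?_⟩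
      obtain ⟨c, rfl⟩ := (Submodule.mem_span_range_iff_exists_fun ℝ).1 hv
      change B _ _ = 0
      rw [bilin_sum_smul_apply_of_orthogonal hdiag hoff, hi]
      simp
  rw [hrad]
  exact finrank_span_eq_card (hf.comp _ Subtype.val_injective)

end Signature

section NormalForm

variable {V : Type*} [AddCommGroup V] [Module ℝ V] {B : LinearMap.BilinForm ℝ V}

theorem exists_unit_mul_self_mul_eq_sign (q : ℝ) :
    ∃ r : ℝˣ, (r : ℝ) * (r * q) = SignType.sign q := by
  rcases lt_trichotomy q 0 with h | rfl | h
  · have hs : √(-q) ≠ 0 := (Real.sqrt_pos.2 (by linarith)).ne'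
    refine ⟨(Units.mk0 _ hs)⁻¹, ?_⟩
    have := Real.mul_self_sqrt (show 0 ≤ -q by linarith)
    simp only [Units.val_inv_eq_inv_val, Units.val_mk0, sign_neg h, SignType.coe_neg_one]
    field_simp
    nlinarith
  · exact ⟨1, by simp⟩
  · have hs : √q ≠ 0 := (Real.sqrt_pos.2 h).ne'
    refine ⟨(Units.mk0 _ hs)⁻¹, ?_⟩
    have := Real.mul_self_sqrt h.le
    simp only [Units.val_inv_eq_inv_val, Units.val_mk0, sign_pos h, SignType.coe_one]
    field_simp
    nlinarith

theorem span_range_coe_basis {ι : Type*} {D : Submodule ℝ V} (b : Basis ι ℝ D) :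
    Submodule.span ℝ (Set.range fun i => (b i : V)) = D := by
  have : (Set.range fun i => (b i : V)) = D.subtype '' Set.range b := by
    rw [← Set.range_comp]
    rfl
  rw [this, Submodule.span_image, b.span_eq, Submodule.map_top, Submodule.range_subtype]

theorem linearIndependent_coe_basis {ι : Type*} {D : Submodule ℝ V} (b : Basis ι ℝ D) :
    LinearIndependent ℝ fun i => (b i : V) :=
  b.linearIndependent.map' D.subtype D.ker_subtype

/-- A subspace `T` with a subspace `A` of its radical has a basis adapted to `A` which is
orthogonal with values in `{-1, 0, 1}`. -/
theorem exists_orthogonal_family_adapted [FiniteDimensional ℝ V]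
    (hBsymm : ∀ x y : V, B x y = B y x)
    {T A : Submodule ℝ V} (hAT : A ≤ T) (hA : ∀ a ∈ A, ∀ t ∈ T, B a t = 0) :
    ∃ (n : ℕ) (ε : Fin n → SignType) (e : Fin n → V) (a : Fin (finrank ℝ A) → V),
      LinearIndependent ℝ (Sum.elim e a) ∧ Submodule.span ℝ (Set.range (Sum.elim e a)) = T ∧
      Submodule.span ℝ (Set.range a) = A ∧
      (∀ i, B (Sum.elim e a i) (Sum.elim e a i) = Sum.elim ε (fun _ => 0) i) ∧
      ∀ i j, i ≠ j → B (Sum.elim e a i) (Sum.elim e a j) = 0 := by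
  obtain ⟨C, hC⟩ := A.exists_isCompl
  have hsup : A ⊔ C ⊓ T = T := by
    rw [← sup_inf_assoc_of_le C hAT, hC.sup_eq_top, top_inf_eq]
  have hdisj : Disjoint (C ⊓ T) A := hC.disjoint.symm.mono_left inf_le_left
  obtain ⟨b, hb⟩ := LinearMap.BilinForm.exists_orthogonal_basis (B := B.restrict (C ⊓ T))
    ⟨fun x y => hBsymm x y⟩
  have hb' : ∀ i j, i ≠ j → B (b i) (b j) = 0 := fun i j hij => hb hij
  choose r hr using fun i => exists_unit_mul_self_mul_eq_sign (B (b i) (b i))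
  have hev : ∀ i, (b.unitsSMul r i : V) = (r i : ℝ) • (b i : V) := fun i => by
    rw [Basis.unitsSMul_apply]
    rfl
  let d := Module.finBasis ℝ A
  have hspan_e := span_range_coe_basis (b.unitsSMul r)
  have hspan_a := span_range_coe_basis d
  have heT : ∀ i, (b.unitsSMul r i : V) ∈ T := fun i => (b.unitsSMul r i).2.2
  have hda : ∀ k, ∀ t ∈ T, B (d k) t = 0 := fun k => hA _ (d k).2
  refine ⟨_, fun i => SignType.sign (B (b i) (b i)), fun i => (b.unitsSMul r i : V),
    fun k => (d k : V), ?_, ?_, hspan_a, ?_, ?_⟩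
  · refine linearIndependent_sum.2 ⟨linearIndependent_coe_basis _,
      linearIndependent_coe_basis _, ?_⟩
    simp only [Sum.elim_comp_inl, Sum.elim_comp_inr]
    rw [hspan_e, hspan_a]
    exact hdisj
  · rw [Set.Sum.elim_range, Submodule.span_union, hspan_e, hspan_a, sup_comm, hsup]
  · rintro (i | k)
    · simp [hev, hr]
    · simpa using hda k _ (hAT (d k).2)
  · rintro (i | k) (j | l) hij
    · have hij' : i ≠ j := fun h => hij (by rw [h])
      simp [hev, hb' i j hij']
    · rw [hBsymm]
      exact hda l _ (heT i)
    · exact hda k _ (heT j)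
    · exact hda k _ (hAT (d l).2)

/-- Normal form of an isotropic subspace `S` of an orthogonal direct sum of `U` and `W`. -/
theorem exists_isotropic_normal_form [FiniteDimensional ℝ V]
    (hBsymm : ∀ x y : V, B x y = B y x)
    {U W : Submodule ℝ V} (hUWtop : U ⊔ W = ⊤)
    (horth : ∀ u ∈ U, ∀ w ∈ W, B u w = 0) {S : Submodule ℝ V}
    (hS : ∀ s ∈ S, ∀ s' ∈ S, B s s' = 0) :
    ∃ (n : ℕ) (ε : Fin n → SignType) (e w : Fin n → V)
      (a : Fin (finrank ℝ (S ⊓ U : Submodule ℝ V)) → V)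
      (c : Fin (finrank ℝ (S ⊓ W : Submodule ℝ V)) → V),
      LinearIndependent ℝ (Sum.elim e a) ∧ LinearIndependent ℝ (Sum.elim w c) ∧
      (∀ i, Sum.elim e a i ∈ U) ∧ (∀ i, Sum.elim w c i ∈ W) ∧
      S = Submodule.span ℝ (Set.range (Sum.elim (fun i => e i + w i) (Sum.elim a c))) ∧
      (∀ i, B (Sum.elim e a i) (Sum.elim e a i) = Sum.elim ε (fun _ => 0) i) ∧
      (∀ i j, i ≠ j → B (Sum.elim e a i) (Sum.elim e a j) = 0) ∧
      (∀ i, B (Sum.elim w c i) (Sum.elim w c i) = -Sum.elim ε (fun _ => 0) i) ∧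
      (∀ i j, i ≠ j → B (Sum.elim w c i) (Sum.elim w c j) = 0) ∧
      posIdx B (projAlong W U S) = Fintype.card {i // ε i = 1} ∧
      negIdx B (projAlong W U S) = Fintype.card {i // ε i = -1} ∧
      finrank ℝ (bilinRad B (projAlong W U S)) =
        Fintype.card {i // ε i = 0} + finrank ℝ (S ⊓ U : Submodule ℝ V) := by
  have hP : ∀ u ∈ projAlong W U S, u ∈ U ∧ ∃ w ∈ W, u + w ∈ S := by
    rintro u ⟨hu, huU⟩
    obtain ⟨s, hs, w, hw, rfl⟩ := Submodule.mem_sup.1 hu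
    exact ⟨huU, -w, W.neg_mem hw, by simpa using hs⟩
  obtain ⟨n, ε, e, a, hli, hspan, hspan_a, hdiag, hoff⟩ :=
    exists_orthogonal_family_adapted (B := B) hBsymm (T := projAlong W U S) (A := S ⊓ U)
      (fun x hx => ⟨Submodule.mem_sup_left hx.1, hx.2⟩)
      (fun x hx t ht => by
        obtain ⟨htU, w, hw, hwS⟩ := hP t ht
        have h := hS x hx.1 _ hwS
        rwa [map_add, horth x hx.2 w hw, add_zero] at h)
  have hmem : ∀ i, Sum.elim e a i ∈ projAlong W U S := fun i => by
    rw [← hspan]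
    exact Submodule.subset_span ⟨i, rfl⟩
  have haSU : ∀ k, a k ∈ S ⊓ U := fun k => by
    rw [← hspan_a]
    exact Submodule.subset_span ⟨k, rfl⟩
  choose w hwW hwS using fun i => (hP (e i) (hmem (Sum.inl i))).2
  have heU : ∀ i, e i ∈ U := fun i => (hP (e i) (hmem (Sum.inl i))).1
  let d := Module.finBasis ℝ (S ⊓ W : Submodule ℝ V)
  have hspan_c := span_range_coe_basis d
  have hcard : ∀ s, Fintype.card {i // Sum.elim ε (fun _ : Fin (finrank ℝ
      (S ⊓ U : Submodule ℝ V)) => (0 : SignType)) i = s} =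
      Fintype.card {i // ε i = s} + if s = 0 then finrank ℝ (S ⊓ U : Submodule ℝ V) else 0 := by
    intro s
    rw [Fintype.card_congr (Equiv.subtypeSum ..), Fintype.card_sum]
    by_cases hs : s = 0
    · simp [hs]
    · simp only [hs, Ne.symm hs, Sum.elim_inl, Sum.elim_inr, Fintype.card_eq_zero, if_false,
        add_zero]
      exact Fintype.card_congr (Equiv.refl _)
  have hwe : ∀ i j, B (w i) (w j) = -B (e i) (e j) := fun i j => by
    have h := hS _ (hwS i) _ (hwS j)
    simp only [map_add, LinearMap.add_apply, horth _ (heU i) _ (hwW j),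
      hBsymm (w i) (e j), horth _ (heU j) _ (hwW i)] at h
    linarith
  have hdw : ∀ k i, B (d k) (w i) = 0 := fun k i => by
    have h := hS _ (d k).2.1 _ (hwS i)
    rwa [map_add, hBsymm _ (e i), horth _ (heU i) _ (d k).2.2, zero_add] at h
  refine ⟨n, ε, e, w, a, fun k => (d k : V), hli, ?_, fun i => (hP _ (hmem i)).1, ?_, ?_, hdiag,
    hoff, ?_, ?_, ?_, ?_, ?_⟩
  · have hzero : ∀ l : Fin n → ℝ, ∑ i, l i • w i ∈ S → ∀ i, l i = 0 := by
      intro l hl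
      have h1 : ∑ i, l i • e i ∈ S := by
        have h2 : ∑ i, l i • (e i + w i) ∈ S :=
          S.sum_mem fun i _ => S.smul_mem _ (hwS i)
        have h3 : ∑ i, l i • e i = ∑ i, l i • (e i + w i) - ∑ i, l i • w i := by
          simp [smul_add, Finset.sum_add_distrib]
        rw [h3]
        exact S.sub_mem h2 hl
      have h2 : ∑ i, l i • e i ∈ Submodule.span ℝ (Set.range a) := by
        rw [hspan_a]
        exact ⟨h1, U.sum_mem fun i _ => U.smul_mem _ (heU i)⟩
      obtain ⟨he, -, hd⟩ := linearIndependent_sum.1 hli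
      have h3 : ∑ i, l i • e i = 0 := Submodule.disjoint_def.1 hd _
        ((Submodule.mem_span_range_iff_exists_fun ℝ).2 ⟨l, rfl⟩) h2
      exact Fintype.linearIndependent_iff.1 he l h3
    refine linearIndependent_sum.2 ⟨?_, linearIndependent_coe_basis d, ?_⟩
    · refine Fintype.linearIndependent_iff.2 fun l hl => hzero l ?_
      simp only [Sum.elim_comp_inl] at hl
      simp [hl]
    · rw [Sum.elim_comp_inl, Sum.elim_comp_inr, hspan_c]
      refine Submodule.disjoint_def.2 fun v hv hvS => ?_
      obtain ⟨l, rfl⟩ := (Submodule.mem_span_range_iff_exists_fun ℝ).1 hv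
      simp [hzero l hvS.1]
  · rintro (i | k)
    · exact hwW i
    · exact (d k).2.2
  · apply le_antisymm
    · intro s hs
      obtain ⟨u, hu, v, hv, rfl⟩ := Submodule.mem_sup.1 (hUWtop ▸ Submodule.mem_top : s ∈ U ⊔ W)
      have huP : u ∈ projAlong W U S :=
        ⟨Submodule.mem_sup.2 ⟨_, hs, -v, W.neg_mem hv, by abel⟩, hu⟩
      rw [← hspan] at huP
      obtain ⟨l, rfl⟩ := (Submodule.mem_span_range_iff_exists_fun ℝ).1 huP
      simp only [Fintype.sum_sum_type, Sum.elim_inl, Sum.elim_inr] at hs hu ⊢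
      have h1 : ∑ i, l (Sum.inl i) • (e i + w i) ∈ S :=
        S.sum_mem fun i _ => S.smul_mem _ (hwS i)
      have h2 : ∑ k, l (Sum.inr k) • a k ∈ S :=
        S.sum_mem fun k _ => S.smul_mem _ (haSU k).1
      have h3 : v - ∑ i, l (Sum.inl i) • w i ∈
          Submodule.span ℝ (Set.range fun k => (d k : V)) := by
        rw [hspan_c]
        refine ⟨?_, W.sub_mem hv (W.sum_mem fun i _ => W.smul_mem _ (hwW i))⟩
        have h4 := S.sub_mem (S.sub_mem hs h1) h2
        have h5 : v - ∑ i, l (Sum.inl i) • w i = ∑ i, l (Sum.inl i) • e i +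
            ∑ k, l (Sum.inr k) • a k + v - ∑ i, l (Sum.inl i) • (e i + w i) -
            ∑ k, l (Sum.inr k) • a k := by
          simp only [smul_add, Finset.sum_add_distrib]
          abel
        rwa [h5]
      have h6 : ∑ i, l (Sum.inl i) • e i + ∑ k, l (Sum.inr k) • a k + v =
          ∑ i, l (Sum.inl i) • (e i + w i) + (∑ k, l (Sum.inr k) • a k +
          (v - ∑ i, l (Sum.inl i) • w i)) := by
        simp only [smul_add, Finset.sum_add_distrib]
        abel
      rw [h6, Set.Sum.elim_range, Set.Sum.elim_range, Submodule.span_union,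
        Submodule.span_union]
      exact Submodule.add_mem_sup
        ((Submodule.mem_span_range_iff_exists_fun ℝ).2 ⟨_, rfl⟩)
        (Submodule.add_mem_sup ((Submodule.mem_span_range_iff_exists_fun ℝ).2 ⟨_, rfl⟩) h3)
    · refine Submodule.span_le.2 ?_
      rintro _ ⟨i | k | k, rfl⟩
      · exact hwS i
      · exact (haSU k).1
      · exact (d k).2.1
  · rintro (i | k)
    · simpa [hwe] using hdiag (Sum.inl i)
    · simpa using hS _ (d k).2.1 _ (d k).2.1
  · rintro (i | k) (j | l) hij
    · have h := hoff (Sum.inl i) (Sum.inl j) fun h => hij (by rw [Sum.inl.inj h])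
      simpa [hwe] using h
    · rw [hBsymm]
      exact hdw l i
    · exact hdw k j
    · exact hS _ (d k).2.1 _ (d l).2.1
  · rw [← hspan, posIdx_span_of_orthogonal hli hdiag hoff, hcard]
    simp
  · rw [← hspan, negIdx_span_of_orthogonal hli hdiag hoff, hcard]
    simp
  · rw [← hspan, finrank_bilinRad_span_of_orthogonal hli hdiag hoff hBsymm, hcard]
    simp

end NormalForm

/-- Two families of signs with equally many occurrences of each sign differ by a bijection. -/
theorem exists_equiv_comp_eq_of_card_fiber_eq {ι κ : Type*} [Fintype ι] [Fintype κ]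
    {ε : ι → SignType} {δ : κ → SignType}
    (h : ∀ s, Fintype.card {i // ε i = s} = Fintype.card {j // δ j = s}) :
    ∃ σ : ι ≃ κ, ∀ i, δ (σ i) = ε i := by
  let τ := fun s => Fintype.equivOfCardEq (h s)
  refine ⟨(Equiv.sigmaFiberEquiv ε).symm.trans
    ((Equiv.sigmaCongrRight τ).trans (Equiv.sigmaFiberEquiv δ)), fun i => ?_⟩
  exact (τ (ε i) ⟨i, rfl⟩).2

/-- Two orthogonal families with the same self-pairings have the same Gram matrix. -/
theorem bilin_eq_of_orthogonal {V ι : Type*} [AddCommGroup V] [Module ℝ V]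
    {B : LinearMap.BilinForm ℝ V} {x y : ι → V} (hdiag : ∀ i, B (x i) (x i) = B (y i) (y i))
    (hx : ∀ i j, i ≠ j → B (x i) (x j) = 0) (hy : ∀ i j, i ≠ j → B (y i) (y j) = 0)
    (i j : ι) : B (x i) (x j) = B (y i) (y j) := by
  by_cases hij : i = j
  · rw [hij, hdiag]
  · rw [hx i j hij, hy i j hij]

/-- If `W` is the orthogonal complement of `U`, an isometry fixing `W` pointwise preserves `U`. -/
theorem map_mem_of_isometry_fixing {V : Type*} [AddCommGroup V] [Module ℝ V]
    {B : LinearMap.BilinForm ℝ V} (hBsymm : ∀ x y : V, B x y = B y x)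
    (hBnd : ∀ x : V, (∀ y : V, B x y = 0) → x = 0) {U W : Submodule ℝ V} (hUWtop : U ⊔ W = ⊤)
    (horth : ∀ u ∈ U, ∀ w ∈ W, B u w = 0) {g : V → V} (hg : ∀ x y : V, B (g x) (g y) = B x y)
    (hgW : ∀ w ∈ W, g w = w) {u : V} (hu : u ∈ U) : g u ∈ U := by
  obtain ⟨p, hp, q, hq, hsum⟩ := Submodule.mem_sup.1 (hUWtop ▸ Submodule.mem_top : g u ∈ U ⊔ W)
  have hqW : ∀ w ∈ W, B q w = 0 := fun w hw => by
    have h : B (p + q) w = B u w := by rw [hsum, ← hg u w, hgW w hw]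
    rwa [map_add, LinearMap.add_apply, horth p hp w hw, horth u hu w hw, zero_add] at h
  have hq0 : q = 0 := hBnd q fun y => by
    obtain ⟨u', hu', w, hw, rfl⟩ := Submodule.mem_sup.1 (hUWtop ▸ Submodule.mem_top : y ∈ U ⊔ W)
    rw [map_add, hqW w hw, hBsymm, horth u' hu' q hq, add_zero]
  rwa [← hsum, hq0, add_zero]

/-- two isotropic subspaces with the same invariants are in the same
orbit of the symmetric subgroup. -/
theorem stmt_5 (V : Type*) [AddCommGroup V] [Module ℝ V] [FiniteDimensional ℝ V]
    (B : LinearMap.BilinForm ℝ V)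
    (hBsymm : ∀ x y : V, B x y = B y x)
    (hBnd : ∀ x : V, (∀ y : V, B x y = 0) → x = 0)
    (U W : Submodule ℝ V) (hUW : U ⊓ W = ⊥) (hUWtop : U ⊔ W = ⊤)
    (horth : ∀ u ∈ U, ∀ w ∈ W, B u w = 0)
    (S S' : Submodule ℝ V)
    (hS : ∀ s ∈ S, ∀ s' ∈ S, B s s' = 0)
    (hS' : ∀ s ∈ S', ∀ s' ∈ S', B s s' = 0)
    (h1 : finrank ℝ (S ⊓ U : Submodule ℝ V) = finrank ℝ (S' ⊓ U : Submodule ℝ V))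
    (h2 : finrank ℝ (S ⊓ W : Submodule ℝ V) = finrank ℝ (S' ⊓ W : Submodule ℝ V))
    (h3 : finrank ℝ (bilinRad B (projAlong W U S)) = finrank ℝ (bilinRad B (projAlong W U S')))
    (h4 : posIdx B (projAlong W U S) = posIdx B (projAlong W U S'))
    (h5 : negIdx B (projAlong W U S) = negIdx B (projAlong W U S')) :
    ∃ g : V ≃ₗ[ℝ] V, (∀ x y : V, B (g x) (g y) = B x y) ∧
      Submodule.map (g : V →ₗ[ℝ] V) U = U ∧
      Submodule.map (g : V →ₗ[ℝ] V) W = W ∧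
      Submodule.map (g : V →ₗ[ℝ] V) S = S' := by
  obtain ⟨n, ε, e, w, a, c, hea, hwc, heaU, hwcW, hSspan, hdU, hoU, hdW, hoW, hp, hn, hr⟩ :=
    exists_isotropic_normal_form hBsymm hUWtop horth hS
  obtain ⟨n', ε', e', w', a', c', hea', hwc', heaU', hwcW', hSspan', hdU', hoU', hdW', hoW', hp',
    hn', hr'⟩ := exists_isotropic_normal_form hBsymm hUWtop horth hS'
  obtain ⟨σ, hσ⟩ := exists_equiv_comp_eq_of_card_fiber_eq (ε := ε) (δ := ε') (by
    rintro (_ | _ | _)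
    · exact Nat.add_right_cancel (hr.symm.trans (h3.trans (hr'.trans (congrArg _ h1.symm))))
    · exact hn.symm.trans (h5.trans hn')
    · exact hp.symm.trans (h4.trans hp'))
  let α := Equiv.sumCongr σ (finCongr h1)
  let β := Equiv.sumCongr σ (finCongr h2)
  have horth' : ∀ w ∈ W, ∀ u ∈ U, B w u = 0 := fun w hw u hu => by
    rw [hBsymm, horth u hu w hw]
  have hdisj : Disjoint U W := disjoint_iff.2 hUW
  obtain ⟨g, hg, hgW, hgx⟩ := exists_isometry_extending hBsymm hBnd hdisj horth
    (x := Sum.elim e a) (y := Sum.elim e' a' ∘ α) heaU (fun i => heaU' _) hea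
    (hea'.comp _ α.injective)
    (bilin_eq_of_orthogonal
      (by rintro (i | k) <;> simp only [Function.comp_apply, hdU, hdU'] <;> simp [α, hσ])
      hoU fun i j hij => hoU' _ _ (α.injective.ne hij))
  obtain ⟨h, hh, hhU, hhx⟩ := exists_isometry_extending hBsymm hBnd hdisj.symm horth'
    (x := Sum.elim w c) (y := Sum.elim w' c' ∘ β) hwcW (fun i => hwcW' _) hwc
    (hwc'.comp _ β.injective)
    (bilin_eq_of_orthogonal
      (by rintro (i | k) <;> simp only [Function.comp_apply, hdW, hdW'] <;> simp [β, hσ])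
      hoW fun i j hij => hoW' _ _ (β.injective.ne hij))
  have hhW : ∀ v ∈ W, h v ∈ W := fun v hv =>
    map_mem_of_isometry_fixing hBsymm hBnd (by rwa [sup_comm]) horth' hh hhU hv
  have hgU : ∀ v ∈ U, g v ∈ U := fun v hv =>
    map_mem_of_isometry_fixing hBsymm hBnd hUWtop horth hg hgW hv
  have map_eq : ∀ (f : V ≃ₗ[ℝ] V) (X : Submodule ℝ V), (∀ v ∈ X, f v ∈ X) →
      X.map (f : V →ₗ[ℝ] V) = X := fun f X hX =>
    Submodule.eq_of_le_of_finrank_eq (Submodule.map_le_iff_le_comap.2 hX)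
      (LinearEquiv.finrank_map_eq f X)
  have hkU : ∀ v ∈ U, (h.trans g) v = g v := fun v hv => by simp [hhU v hv]
  have hkW : ∀ v ∈ W, (h.trans g) v = h v := fun v hv => by simp [hgW _ (hhW v hv)]
  refine ⟨h.trans g, fun x y => by simp [hg, hh], map_eq _ U fun v hv => ?_,
    map_eq _ W fun v hv => ?_, ?_⟩
  · rw [hkU v hv]
    exact hgU v hv
  · rw [hkW v hv]
    exact hhW v hv
  · let γ := Equiv.sumCongr σ (Equiv.sumCongr (finCongr h1) (finCongr h2))
    have hke : ∀ i, (h.trans g) (Sum.elim e a i) = Sum.elim e' a' (α i) := fun i => by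
      rw [hkU _ (heaU i), hgx, Function.comp_apply]
    have hkw : ∀ i, (h.trans g) (Sum.elim w c i) = Sum.elim w' c' (β i) := fun i => by
      rw [hkW _ (hwcW i), hhx, Function.comp_apply]
    have hcomp : ((h.trans g : V ≃ₗ[ℝ] V) : V →ₗ[ℝ] V) ∘
        Sum.elim (fun i => e i + w i) (Sum.elim a c) =
        Sum.elim (fun i => e' i + w' i) (Sum.elim a' c') ∘ γ := by
      funext i
      rcases i with i | k | k
      · exact (map_add (h.trans g) _ _).trans
          (congrArg₂ (· + ·) (hke (Sum.inl i)) (hkw (Sum.inl i)))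
      · exact hke (Sum.inr k)
      · exact hkw (Sum.inr k)
    rw [hSspan, Submodule.map_span, ← Set.range_comp, hcomp, γ.surjective.range_comp, ← hSspan']
end

section
/- Let S and S' be isotropic subspaces of V such that dim(S ∩ U) = dim(S' ∩ U), dim(S ∩ W) = dim(S' ∩ W), dim Rad(proj_U S) = dim Rad(proj_U S'), posIdx(proj_U S) = posIdx(proj_U S'), and negIdx(proj_U S) = negIdx(proj_U S'). Then there exists a complex-linear automorphism g of V with B(g x, g y) = B(x, y) for all x, y ∈ V, g(U) = U, g(W) = W, and g(S) = S'. -/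
open Module
open scoped ComplexOrder

/-- Orthogonal complement `T^⊥ = {v | ∀ t ∈ T, B t v = 0}` of a subspace with respect
to a sesquilinear form `B`. -/
def sesqOrth {V : Type*} [AddCommGroup V] [Module ℂ V]
    (B : V →ₛₗ[starRingEnd ℂ] V →ₗ[ℂ] ℂ) (T : Submodule ℂ V) : Submodule ℂ V where
  carrier := {v | ∀ t ∈ T, B t v = 0}
  add_mem' := by
    intro a b ha hb t ht
    simp [map_add, ha t ht, hb t ht]
  zero_mem' := by intro t ht; simp
  smul_mem' := by
    intro c v hv t ht
    simp [map_smul, hv t ht]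

/-- The radical `T ⊓ T^⊥` of a subspace with respect to a sesquilinear form `B`. -/
def sesqRad {V : Type*} [AddCommGroup V] [Module ℂ V]
    (B : V →ₛₗ[starRingEnd ℂ] V →ₗ[ℂ] ℂ) (T : Submodule ℂ V) : Submodule ℂ V :=
  T ⊓ sesqOrth B T

/-- The maximal dimension of a subspace of `T` on which `B v v > 0` for all nonzero `v`. -/
noncomputable def posIdxH {V : Type*} [AddCommGroup V] [Module ℂ V]
    (B : V →ₛₗ[starRingEnd ℂ] V →ₗ[ℂ] ℂ) (T : Submodule ℂ V) : ℕ :=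
  sSup {n : ℕ | ∃ T' : Submodule ℂ V, T' ≤ T ∧ (∀ v ∈ T', v ≠ 0 → 0 < B v v) ∧
    Module.finrank ℂ T' = n}

/-- The maximal dimension of a subspace of `T` on which `B v v < 0` for all nonzero `v`. -/
noncomputable def negIdxH {V : Type*} [AddCommGroup V] [Module ℂ V]
    (B : V →ₛₗ[starRingEnd ℂ] V →ₗ[ℂ] ℂ) (T : Submodule ℂ V) : ℕ :=
  sSup {n : ℕ | ∃ T' : Submodule ℂ V, T' ≤ T ∧ (∀ v ∈ T', v ≠ 0 → B v v < 0) ∧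
    Module.finrank ℂ T' = n}

section PartialIsometry

variable {V : Type*} [AddCommGroup V] [Module ℂ V]

/-- `B` is nondegenerate on the subspace `T`. -/
def NondegOn (B : V →ₛₗ[starRingEnd ℂ] V →ₗ[ℂ] ℂ) (T : Submodule ℂ V) : Prop :=
  ∀ x ∈ T, (∀ y ∈ T, B y x = 0) → x = 0

/-- The subspace `G` of `V × V` is the graph of an isometry between its two projections. -/
structure IsPartialIsometry (B : V →ₛₗ[starRingEnd ℂ] V →ₗ[ℂ] ℂ)
    (G : Submodule ℂ (V × V)) : Prop where
  isometry : ∀ a ∈ G, ∀ b ∈ G, B a.1 b.1 = B a.2 b.2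
  snd_eq_zero : ∀ a ∈ G, a.1 = 0 → a.2 = 0
  fst_eq_zero : ∀ a ∈ G, a.2 = 0 → a.1 = 0

/-- The first projection of a relation. -/
abbrev relDom (G : Submodule ℂ (V × V)) : Submodule ℂ V := G.map (LinearMap.fst ℂ V V)

/-- The second projection of a relation. -/
abbrev relRan (G : Submodule ℂ (V × V)) : Submodule ℂ V := G.map (LinearMap.snd ℂ V V)

/-- The converse relation. -/
abbrev relSwap (G : Submodule ℂ (V × V)) : Submodule ℂ (V × V) :=
  G.comap (LinearEquiv.prodComm ℂ V V : V × V →ₗ[ℂ] V × V)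

variable {B : V →ₛₗ[starRingEnd ℂ] V →ₗ[ℂ] ℂ} {G H : Submodule ℂ (V × V)} {T T' : Submodule ℂ V}

lemma relDom_relSwap : relDom (relSwap G) = relRan G := by
  ext x
  simp [Submodule.mem_map]

lemma relRan_relSwap : relRan (relSwap G) = relDom G := by
  ext x
  simp [Submodule.mem_map]

lemma IsPartialIsometry.swap (hG : IsPartialIsometry B G) : IsPartialIsometry B (relSwap G) where
  isometry _ ha _ hb := (hG.isometry _ ha _ hb).symm
  snd_eq_zero _ ha h := hG.fst_eq_zero _ ha h
  fst_eq_zero _ ha h := hG.snd_eq_zero _ ha h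

lemma IsPartialIsometry.neg (hG : IsPartialIsometry B G) : IsPartialIsometry (-B) G where
  isometry a ha b hb := by simp [hG.isometry a ha b hb]
  snd_eq_zero := hG.snd_eq_zero
  fst_eq_zero := hG.fst_eq_zero

lemma NondegOn.neg (hT : NondegOn B T) : NondegOn (-B) T :=
  fun x hx h => hT x hx fun y hy => by simpa using h y hy

lemma IsPartialIsometry.nondegOn_relRan (hG : IsPartialIsometry B G)
    (hd : NondegOn B (relDom G)) : NondegOn B (relRan G) := by
  rintro _ ⟨a, ha, rfl⟩ h
  refine hG.snd_eq_zero a ha (hd _ ⟨a, ha, rfl⟩ ?_)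
  rintro _ ⟨b, hb, rfl⟩
  exact (hG.isometry b hb a ha).trans (h _ ⟨b, hb, rfl⟩)

lemma IsPartialIsometry.finrank_relDom [FiniteDimensional ℂ V] (hG : IsPartialIsometry B G) :
    finrank ℂ (relDom G) = finrank ℂ G := by
  rw [relDom, ← LinearMap.range_domRestrict]
  refine LinearMap.finrank_range_of_inj ((injective_iff_map_eq_zero _).2 ?_)
  rintro ⟨a, ha⟩ h
  exact Subtype.ext (Prod.ext h (hG.snd_eq_zero a ha h))

lemma IsPartialIsometry.finrank_relRan [FiniteDimensional ℂ V] (hG : IsPartialIsometry B G) :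
    finrank ℂ (relRan G) = finrank ℂ G := by
  rw [← relDom_relSwap, hG.swap.finrank_relDom]
  exact (LinearEquiv.prodComm ℂ V V).submoduleMap _ |>.finrank_eq.trans (by
    rw [Submodule.map_comap_eq_of_surjective (LinearEquiv.surjective _)])

/-- Two partial isometries that are compatible with each other can be glued. -/
lemma IsPartialIsometry.sup (hB : ∀ x y : V, B y x = starRingEnd ℂ (B x y))
    (hG : IsPartialIsometry B G) (hH : IsPartialIsometry B H)
    (h : ∀ a ∈ G, ∀ b ∈ H, B a.1 b.1 = B a.2 b.2)
    (hd : Disjoint (relDom G) (relDom H)) (hr : Disjoint (relRan G) (relRan H)) :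
    IsPartialIsometry B (G ⊔ H) := by
  rw [Submodule.disjoint_def] at hd hr
  refine ⟨?_, ?_, ?_⟩
  · intro x hx y hy
    obtain ⟨a, ha, a', ha', rfl⟩ := Submodule.mem_sup.1 hx
    obtain ⟨b, hb, b', hb', rfl⟩ := Submodule.mem_sup.1 hy
    simp [hG.isometry a ha b hb, hH.isometry a' ha' b' hb', h a ha b' hb', hB b.1 a'.1,
      hB b.2 a'.2, h b hb a' ha']
  · intro x hx h0
    obtain ⟨a, ha, b, hb, rfl⟩ := Submodule.mem_sup.1 hx
    have e : a.1 = -b.1 := eq_neg_of_add_eq_zero_left h0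
    have e0 : a.1 = 0 := hd _ ⟨a, ha, rfl⟩ (by
      rw [e]; exact neg_mem ⟨b, hb, rfl⟩)
    have e1 : b.1 = 0 := by simpa [e0] using e.symm
    simp [hG.snd_eq_zero a ha e0, hH.snd_eq_zero b hb e1]
  · intro x hx h0
    obtain ⟨a, ha, b, hb, rfl⟩ := Submodule.mem_sup.1 hx
    have e : a.2 = -b.2 := eq_neg_of_add_eq_zero_left h0
    have e0 : a.2 = 0 := hr _ ⟨a, ha, rfl⟩ (by
      rw [e]; exact neg_mem ⟨b, hb, rfl⟩)
    have e1 : b.2 = 0 := by simpa [e0] using e.symm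
    simp [hG.fst_eq_zero a ha e0, hH.fst_eq_zero b hb e1]

lemma relDom_span_singleton (v v' : V) : relDom (ℂ ∙ (v, v')) = ℂ ∙ v := by
  simp [relDom, Submodule.map_span]

lemma relRan_span_singleton (v v' : V) : relRan (ℂ ∙ (v, v')) = ℂ ∙ v' := by
  simp [relRan, Submodule.map_span]

/-- A partial isometry can be extended by one vector outside of its domain. -/
lemma IsPartialIsometry.sup_span_singleton (hB : ∀ x y : V, B y x = starRingEnd ℂ (B x y))
    (hG : IsPartialIsometry B G) {v v' : V} (hv : v ∉ relDom G) (hv' : v' ∉ relRan G)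
    (h : ∀ a ∈ G, B a.1 v = B a.2 v') (hvv : B v v = B v' v') :
    IsPartialIsometry B (G ⊔ ℂ ∙ (v, v')) := by
  have hv0 : v ≠ 0 := fun h => hv (h ▸ zero_mem _)
  have hv0' : v' ≠ 0 := fun h => hv' (h ▸ zero_mem _)
  refine hG.sup hB ⟨?_, ?_, ?_⟩ ?_ ?_ ?_
  · intro a ha b hb
    obtain ⟨c, rfl⟩ := Submodule.mem_span_singleton.1 ha
    obtain ⟨d, rfl⟩ := Submodule.mem_span_singleton.1 hb
    simp [hvv]
  · intro a ha h0
    obtain ⟨c, rfl⟩ := Submodule.mem_span_singleton.1 ha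
    simpa [hv0, hv0'] using h0
  · intro a ha h0
    obtain ⟨c, rfl⟩ := Submodule.mem_span_singleton.1 ha
    simpa [hv0, hv0'] using h0
  · intro a ha b hb
    obtain ⟨c, rfl⟩ := Submodule.mem_span_singleton.1 hb
    simp [h a ha]
  · rw [relDom_span_singleton]
    exact (Submodule.disjoint_span_singleton' hv0).2 hv
  · rw [relRan_span_singleton]
    exact (Submodule.disjoint_span_singleton' hv0').2 hv'

/-- A vector realising prescribed products with the range of a partial isometry. -/
lemma IsPartialIsometry.exists_forall_apply_eq [FiniteDimensional ℂ V]
    (hB : ∀ x y : V, B y x = starRingEnd ℂ (B x y))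
    (hG : IsPartialIsometry B G) (hGT : relRan G ≤ T) (hT : NondegOn B T) (v : V) :
    ∃ v' ∈ T, ∀ a ∈ G, B a.2 v' = B a.1 v := by
  let Φ : T →ₛₗ[starRingEnd ℂ] Module.Dual ℂ G :=
    { toFun := fun t => (B t).comp ((LinearMap.snd ℂ V V).comp G.subtype)
      map_add' := fun x y => by ext; simp
      map_smul' := fun c x => by ext; simp }
  have hΦ : LinearMap.range Φ = ⊤ := by
    rw [← Subspace.dualCoannihilator_dualAnnihilator_eq (W := LinearMap.range Φ)]
    rw [show (LinearMap.range Φ).dualCoannihilator = ⊥ from ?_]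
    · simp
    rw [eq_bot_iff]
    rintro ⟨a, ha⟩ h
    rw [Submodule.mem_dualCoannihilator] at h
    have h2 : a.2 = 0 := hT _ (hGT ⟨a, ha, rfl⟩) fun y hy => h _ ⟨⟨y, hy⟩, rfl⟩
    exact (Submodule.mem_bot _).2 (Subtype.ext (Prod.ext (hG.fst_eq_zero a ha h2) h2))
  obtain ⟨t, ht⟩ : (B v).comp ((LinearMap.fst ℂ V V).comp G.subtype) ∈ LinearMap.range Φ := by
    rw [hΦ]; trivial
  refine ⟨t, t.2, fun a ha => ?_⟩
  have := LinearMap.congr_fun ht ⟨a, ha⟩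
  rw [hB t a.2, hB v a.1]
  exact congrArg _ this

lemma bddAbove_finrank_setOf [FiniteDimensional ℂ V] (p : Submodule ℂ V → Prop) :
    BddAbove {n : ℕ | ∃ T' : Submodule ℂ V, T' ≤ T ∧ p T' ∧ finrank ℂ T' = n} :=
  ⟨finrank ℂ V, by rintro _ ⟨T', -, -, rfl⟩; exact Submodule.finrank_le _⟩

lemma finrank_le_posIdxH [FiniteDimensional ℂ V] {N : Submodule ℂ V} (hN : N ≤ T)
    (hpos : ∀ v ∈ N, v ≠ 0 → 0 < B v v) : finrank ℂ N ≤ posIdxH B T :=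
  le_csSup (bddAbove_finrank_setOf _) ⟨N, hN, hpos, rfl⟩

lemma exists_finrank_eq_posIdxH [FiniteDimensional ℂ V] (B : V →ₛₗ[starRingEnd ℂ] V →ₗ[ℂ] ℂ)
    (T : Submodule ℂ V) :
    ∃ N ≤ T, (∀ v ∈ N, v ≠ 0 → 0 < B v v) ∧ finrank ℂ N = posIdxH B T :=
  Nat.sSup_mem (s := {n : ℕ | ∃ N : Submodule ℂ V, N ≤ T ∧ (∀ v ∈ N, v ≠ 0 → 0 < B v v) ∧
    finrank ℂ N = n}) ⟨0, ⊥, bot_le, by simp, by simp⟩ (bddAbove_finrank_setOf _)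

lemma posIdxH_neg (B : V →ₛₗ[starRingEnd ℂ] V →ₗ[ℂ] ℂ) (T : Submodule ℂ V) :
    posIdxH (-B) T = negIdxH B T := by
  simp [posIdxH, negIdxH]

/-- A Hermitian form takes real values on the diagonal. -/
lemma exists_ofReal_eq_apply_self (hB : ∀ x y : V, B y x = starRingEnd ℂ (B x y)) (v : V) :
    ∃ r : ℝ, B v v = r :=
  Complex.conj_eq_iff_real.1 (hB v v).symm

/-- If the orthogonal complement of the domain contains a positive vector, then so does the
orthogonal complement of the range. -/
lemma IsPartialIsometry.exists_pos_orthogonal [FiniteDimensional ℂ V]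
    (hB : ∀ x y : V, B y x = starRingEnd ℂ (B x y))
    (hG : IsPartialIsometry B G) (hGT : relDom G ≤ T) (hGT' : relRan G ≤ T')
    (hd : NondegOn B (relDom G)) (hpos : posIdxH B T ≤ posIdxH B T')
    {v : V} (hvT : v ∈ T) (hv : ∀ a ∈ G, B a.1 v = 0) (hvv : 0 < B v v) :
    ∃ v' ∈ T', (∀ a ∈ G, B a.2 v' = 0) ∧ 0 < B v' v' := by
  by_contra! hcon
  obtain ⟨N, hN, hNpos, hNrank⟩ := exists_finrank_eq_posIdxH B (relDom G)
  obtain ⟨N', hN', hNpos', hNrank'⟩ := exists_finrank_eq_posIdxH B T'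
  have hNv : ∀ x ∈ N, B x v = 0 := fun x hx => by
    obtain ⟨a, ha, rfl⟩ := hN hx
    exact hv a ha
  have hlt : finrank ℂ N < finrank ℂ (N ⊔ ℂ ∙ v : Submodule ℂ V) := by
    refine Submodule.finrank_lt_finrank_of_lt (left_lt_sup.2 fun h => ?_)
    exact hvv.ne' (hNv v (h (Submodule.mem_span_singleton_self v)))
  have hle : finrank ℂ (N ⊔ ℂ ∙ v : Submodule ℂ V) ≤ posIdxH B T := by
    refine finrank_le_posIdxH (sup_le (hN.trans hGT) (by simpa using hvT)) ?_
    intro x hx hx0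
    obtain ⟨y, hy, z, hz, rfl⟩ := Submodule.mem_sup.1 hx
    obtain ⟨c, rfl⟩ := Submodule.mem_span_singleton.1 hz
    have e : B (y + c • v) (y + c • v) = B y y + (starRingEnd ℂ c * c) * B v v := by
      have : B v y = 0 := by rw [hB y v, hNv y hy, map_zero]
      simp [hNv y hy, this, mul_assoc]
    rw [e, mul_comm (starRingEnd ℂ c), Complex.mul_conj]
    by_cases hc : c = 0
    · subst hc
      simpa using hNpos y hy (by simpa using hx0)
    · have hcpos : (0 : ℂ) < (Complex.normSq c : ℂ) := by
        exact_mod_cast Complex.normSq_pos.2 hc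
      by_cases hy0 : y = 0
      · simpa [hy0] using mul_pos hcpos hvv
      · exact add_pos (hNpos y hy hy0) (mul_pos hcpos hvv)
  let R : Submodule ℂ (V × (V × V)) :=
    { carrier := {p | p.1 ∈ N' ∧ p.2 ∈ G ∧ ∀ b ∈ G, B b.2 p.1 = B b.2 p.2.2}
      add_mem' := fun {p q} hp hq => ⟨add_mem hp.1 hq.1, add_mem hp.2.1 hq.2.1, fun b hb => by
        simp [hp.2.2 b hb, hq.2.2 b hb]⟩
      zero_mem' := ⟨zero_mem _, zero_mem _, by simp⟩
      smul_mem' := fun c p hp => ⟨N'.smul_mem c hp.1, G.smul_mem c hp.2.1, fun b hb => by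
        simp [hp.2.2 b hb]⟩ }
  have hRpos : ∀ p ∈ R, p.1 ≠ 0 → 0 < B p.2.1 p.2.1 := by
    rintro ⟨t, a⟩ ⟨ht, ha, hta⟩ h0
    dsimp only at ht ha hta h0 ⊢
    replace hta : ∀ b ∈ G, B b.2 (t - a.2) = 0 := fun b hb => by rw [map_sub, hta b hb, sub_self]
    have e : B t t = B a.2 a.2 + B (t - a.2) (t - a.2) := by
      have h1 := hta a ha
      have h2 : B (t - a.2) a.2 = 0 := by rw [hB a.2, h1, map_zero]
      simp only [map_sub, LinearMap.sub_apply] at h1 h2 ⊢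
      linear_combination h1 + h2
    have hneg := hcon (t - a.2) (sub_mem (hN' ht) (hGT' ⟨a, ha, rfl⟩)) hta
    have htt := hNpos' t ht h0
    obtain ⟨r, hr⟩ := exists_ofReal_eq_apply_self hB (t - a.2)
    obtain ⟨s, hs⟩ := exists_ofReal_eq_apply_self hB a.2
    rw [hG.isometry a ha a ha]
    rw [e, hr, hs] at htt
    rw [hr] at hneg
    rw [hs]
    norm_cast at htt hneg ⊢
    linarith
  have hRinj : ∀ p ∈ R, p.2.1 = 0 → p = 0 := by
    intro p hp h0
    have h1 : p.1 = 0 := by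
      by_contra h
      simpa [h0] using hRpos p hp h
    exact Prod.ext h1 (Prod.ext h0 (hG.snd_eq_zero _ hp.2.1 h0))
  have hRdom : R.map (LinearMap.fst ℂ V (V × V)) = N' := by
    refine le_antisymm ?_ ?_
    · rintro _ ⟨p, hp, rfl⟩
      exact hp.1
    · intro t ht
      obtain ⟨d, ⟨a, ha, rfl⟩, h⟩ := hG.swap.exists_forall_apply_eq hB
        (T := relDom G) relRan_relSwap.le hd t
      refine ⟨(t, a), ⟨ht, ha, fun b hb => ?_⟩, rfl⟩
      have := h b.swap hb
      simp only [Prod.fst_swap, Prod.snd_swap, LinearMap.fst_apply] at this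
      exact this.symm.trans (hG.isometry b hb a ha)
  let π : V × (V × V) →ₗ[ℂ] V := (LinearMap.fst ℂ V V).comp (LinearMap.snd ℂ V (V × V))
  have hRrank : finrank ℂ (R.map π) = finrank ℂ R := by
    rw [← LinearMap.range_domRestrict]
    refine LinearMap.finrank_range_of_inj ((injective_iff_map_eq_zero _).2 ?_)
    rintro ⟨p, hp⟩ h
    exact Subtype.ext (hRinj p hp h)
  have hRle : finrank ℂ (R.map π) ≤ posIdxH B (relDom G) := by
    refine finrank_le_posIdxH ?_ ?_
    · rintro _ ⟨p, hp, rfl⟩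
      exact ⟨p.2, hp.2.1, rfl⟩
    · rintro _ ⟨p, hp, rfl⟩ h0
      refine hRpos p hp fun h => h0 ?_
      have h2 : p.2.2 = 0 := by
        refine hG.nondegOn_relRan hd _ ⟨p.2, hp.2.1, rfl⟩ ?_
        rintro _ ⟨b, hb, rfl⟩
        simpa [h] using (hp.2.2 b hb).symm
      exact hG.fst_eq_zero _ hp.2.1 h2
  have := Submodule.finrank_map_le (LinearMap.fst ℂ V (V × V)) R
  rw [hRdom] at this
  omega

lemma relDom_le_relRan_le (h : G ≤ T.prod T') : relDom G ≤ T ∧ relRan G ≤ T' :=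
  ⟨Submodule.map_le_iff_le_comap.2 fun _ ha => (h ha).1,
    Submodule.map_le_iff_le_comap.2 fun _ ha => (h ha).2⟩

/-- A positive vector of `T` orthogonal to the domain has a counterpart of the same length. -/
lemma IsPartialIsometry.exists_orthogonal_of_pos [FiniteDimensional ℂ V]
    (hB : ∀ x y : V, B y x = starRingEnd ℂ (B x y))
    (hG : IsPartialIsometry B G) (hGT : G ≤ T.prod T')
    (hd : NondegOn B (relDom G)) (hpos : posIdxH B T ≤ posIdxH B T')
    {v : V} (hvT : v ∈ T) (hv : ∀ a ∈ G, B a.1 v = 0) (hvv : 0 < B v v) :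
    ∃ v' ∈ T', (∀ a ∈ G, B a.2 v' = 0) ∧ B v' v' = B v v := by
  obtain ⟨hGT₁, hGT₂⟩ := relDom_le_relRan_le hGT
  obtain ⟨w, hwT, hw, hww⟩ := hG.exists_pos_orthogonal hB hGT₁ hGT₂ hd hpos hvT hv hvv
  obtain ⟨r, hr⟩ := exists_ofReal_eq_apply_self hB v
  obtain ⟨s, hs⟩ := exists_ofReal_eq_apply_self hB w
  rw [hr] at hvv
  rw [hs] at hww
  norm_cast at hvv hww
  refine ⟨(√(r / s) : ℂ) • w, T'.smul_mem _ hwT, fun a ha => by simp [hw a ha], ?_⟩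
  simp only [map_smulₛₗ, LinearMap.smul_apply, smul_eq_mul, Complex.conj_ofReal, hs, hr,
    RingHom.id_apply]
  norm_cast
  rw [← mul_assoc, Real.mul_self_sqrt (div_pos hvv hww).le, div_mul_cancel₀ _ hww.ne']

/-- A nondegenerate partial isometry can be extended by an anisotropic vector orthogonal to its
domain. -/
lemma IsPartialIsometry.exists_lt_of_anisotropic [FiniteDimensional ℂ V]
    (hB : ∀ x y : V, B y x = starRingEnd ℂ (B x y))
    (hG : IsPartialIsometry B G) (hGT : G ≤ T.prod T')
    (hd : NondegOn B (relDom G)) (hpos : posIdxH B T ≤ posIdxH B T')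
    (hneg : negIdxH B T ≤ negIdxH B T')
    {v : V} (hvT : v ∈ T) (hv : ∀ a ∈ G, B a.1 v = 0) (hvv : B v v ≠ 0) :
    ∃ G', G < G' ∧ IsPartialIsometry B G' ∧ G' ≤ T.prod T' ∧ NondegOn B (relDom G') := by
  obtain ⟨v', hvT', hv', hvv'⟩ : ∃ v' ∈ T', (∀ a ∈ G, B a.2 v' = 0) ∧ B v' v' = B v v := by
    obtain ⟨r, hr⟩ := exists_ofReal_eq_apply_self hB v
    rcases lt_or_gt_of_ne (show r ≠ 0 by rintro rfl; simp [hr] at hvv) with h | h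
    · simpa using hG.neg.exists_orthogonal_of_pos (fun x y => by simp [hB x y]) hGT hd.neg
        (by simpa only [posIdxH_neg] using hneg) hvT (by simpa using hv)
        (by simpa [hr] using mod_cast h)
    · exact hG.exists_orthogonal_of_pos hB hGT hd hpos hvT hv (by simpa [hr] using h)
  have hvd : v ∉ relDom G := by
    rintro ⟨a, ha, rfl⟩
    exact hvv (hv a ha)
  have hvr : v' ∉ relRan G := by
    rintro ⟨a, ha, rfl⟩
    exact hvv (hvv' ▸ hv' a ha)
  refine ⟨G ⊔ ℂ ∙ (v, v'), left_lt_sup.2 fun h => hvd ?_, hG.sup_span_singleton hB hvd hvr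
    (fun a ha => by rw [hv a ha, hv' a ha]) hvv'.symm, sup_le hGT ?_, ?_⟩
  · exact ⟨_, h (Submodule.mem_span_singleton_self _), rfl⟩
  · simpa using ⟨hvT, hvT'⟩
  · rw [relDom, Submodule.map_sup]
    change NondegOn B (relDom G ⊔ relDom (ℂ ∙ (v, v')))
    rw [relDom_span_singleton]
    intro x hx hx0
    obtain ⟨y, hy, z, hz, rfl⟩ := Submodule.mem_sup.1 hx
    obtain ⟨c, rfl⟩ := Submodule.mem_span_singleton.1 hz
    have hvy : B v y = 0 := by
      obtain ⟨a, ha, rfl⟩ := hy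
      rw [hB, LinearMap.fst_apply, hv a ha, map_zero]
    have hc : c = 0 := by
      have := hx0 v (Submodule.mem_sup_right (Submodule.mem_span_singleton_self v))
      simpa [hvy, hvv] using this
    subst hc
    have hy0 := hd y hy fun u hu => by simpa using hx0 u (Submodule.mem_sup_left hu)
    simp [hy0]

/-- Orthogonal projection of a vector to a nondegenerate domain. -/
lemma IsPartialIsometry.exists_sub_orthogonal [FiniteDimensional ℂ V]
    (hB : ∀ x y : V, B y x = starRingEnd ℂ (B x y)) (hG : IsPartialIsometry B G)
    (hd : NondegOn B (relDom G)) (x : V) :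
    ∃ d ∈ relDom G, ∀ e ∈ relDom G, B e (x - d) = 0 := by
  obtain ⟨r, ⟨a, ha, rfl⟩, h⟩ :=
    hG.exists_forall_apply_eq hB le_rfl (hG.nondegOn_relRan hd) x
  refine ⟨a.1, ⟨a, ha, rfl⟩, ?_⟩
  rintro _ ⟨b, hb, rfl⟩
  have := h b hb
  simp only [LinearMap.snd_apply] at this
  rw [LinearMap.fst_apply, map_sub, ← this, hG.isometry b hb a ha, sub_self]

/-- If all vectors of `C` are isotropic, then `B` vanishes on `C`. -/
lemma apply_eq_zero_of_forall_self {C : Submodule ℂ V} (hC : ∀ x ∈ C, B x x = 0) {x y : V} (hx : x ∈ C) (hy : y ∈ C) :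
    B x y = 0 := by
  have h1 := hC _ (add_mem hx hy)
  have h2 := hC _ (add_mem hx (C.smul_mem Complex.I hy))
  simp only [map_add, LinearMap.add_apply, map_smul, map_smulₛₗ, LinearMap.smul_apply, hC x hx,
    hC y hy, smul_eq_mul, Complex.conj_I] at h1 h2
  linear_combination (1 / 2 : ℂ) * h1 - Complex.I / 2 * h2 +
    ((B x y) - (B y x)) / 2 * Complex.I_mul_I

/-- If the domain is nondegenerate and its orthogonal complement in `T` consists of isotropic
vectors, then that complement is the radical of `T`. -/
lemma IsPartialIsometry.mem_sesqRad_of_orthogonal [FiniteDimensional ℂ V]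
    (hB : ∀ x y : V, B y x = starRingEnd ℂ (B x y)) (hG : IsPartialIsometry B G)
    (hGT : relDom G ≤ T) (hd : NondegOn B (relDom G))
    (hnull : ∀ v ∈ T, (∀ e ∈ relDom G, B e v = 0) → B v v = 0)
    {v : V} (hvT : v ∈ T) (hv : ∀ e ∈ relDom G, B e v = 0) : v ∈ sesqRad B T := by
  refine ⟨hvT, fun t ht => ?_⟩
  obtain ⟨d, hdG, hd'⟩ := hG.exists_sub_orthogonal hB hd t
  have : B (t - d) v = 0 := apply_eq_zero_of_forall_self (C := T ⊓ sesqOrth B (relDom G))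
    (fun x hx => hnull x hx.1 hx.2) ⟨sub_mem ht (hGT hdG), hd'⟩ ⟨hvT, hv⟩
  rwa [map_sub, LinearMap.sub_apply, hv d hdG, sub_zero] at this

lemma IsPartialIsometry.isCompl_sesqRad [FiniteDimensional ℂ V]
    (hB : ∀ x y : V, B y x = starRingEnd ℂ (B x y)) (hG : IsPartialIsometry B G)
    (hGT : relDom G ≤ T) (hd : NondegOn B (relDom G))
    (hnull : ∀ v ∈ T, (∀ e ∈ relDom G, B e v = 0) → B v v = 0) :
    Disjoint (relDom G) (sesqRad B T) ∧ relDom G ⊔ sesqRad B T = T := by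
  refine ⟨Submodule.disjoint_def.2 fun x hx hx' => hd x hx fun y hy => hx'.2 y (hGT hy),
    le_antisymm (sup_le hGT inf_le_left) fun t ht => ?_⟩
  obtain ⟨d, hdG, hd'⟩ := hG.exists_sub_orthogonal hB hd t
  rw [← add_sub_cancel d t]
  exact Submodule.add_mem_sup hdG
    (hG.mem_sesqRad_of_orthogonal hB hGT hd hnull (sub_mem ht (hGT hdG)) hd')

/-- Subspaces with the same signature are isometric modulo their radicals. -/
lemma exists_isPartialIsometry_isCompl_sesqRad [FiniteDimensional ℂ V]
    (hB : ∀ x y : V, B y x = starRingEnd ℂ (B x y))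
    (hpos : posIdxH B T = posIdxH B T') (hneg : negIdxH B T = negIdxH B T') :
    ∃ G, IsPartialIsometry B G ∧
      (Disjoint (relDom G) (sesqRad B T) ∧ relDom G ⊔ sesqRad B T = T) ∧
      (Disjoint (relRan G) (sesqRad B T') ∧ relRan G ⊔ sesqRad B T' = T') := by
  obtain ⟨G, ⟨hG, hGT, hd⟩, hmax⟩ := WellFounded.has_min
    (wellFounded_gt (α := Submodule ℂ (V × V)))
    {G | IsPartialIsometry B G ∧ G ≤ T.prod T' ∧ NondegOn B (relDom G)}
    ⟨⊥, ⟨by simp, by simp, by simp⟩, bot_le, by simp [NondegOn]⟩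
  obtain ⟨hGT₁, hGT₂⟩ := relDom_le_relRan_le hGT
  refine ⟨G, hG, hG.isCompl_sesqRad hB hGT₁ hd fun v hv hv' => ?_, ?_⟩
  · by_contra hvv
    obtain ⟨G', hlt, hG'⟩ := hG.exists_lt_of_anisotropic hB hGT hd hpos.le hneg.le hv
      (fun a ha => hv' _ ⟨a, ha, rfl⟩) hvv
    exact hmax G' hG' hlt
  · rw [← relDom_relSwap] at hGT₂ ⊢
    have hd' : NondegOn B (relDom (relSwap G)) := by
      rw [relDom_relSwap]; exact hG.nondegOn_relRan hd
    refine hG.swap.isCompl_sesqRad hB hGT₂ hd' fun v hv hv' => ?_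
    by_contra hvv
    obtain ⟨G', hlt, hG', hGT', hdG'⟩ := hG.swap.exists_lt_of_anisotropic hB (T := T') (T' := T)
      (fun a ha => (hGT ha).symm) hd' hpos.ge hneg.ge hv
      (fun a ha => hv' _ ⟨a, ha, rfl⟩) hvv
    refine hmax (relSwap G') ⟨hG'.swap, fun a ha => (hGT' ha).symm, ?_⟩
      ⟨fun a ha => hlt.le (show a.swap ∈ relSwap G from ha), fun h => hlt.not_ge fun a ha => h ha⟩
    rw [relDom_relSwap]
    exact hG'.nondegOn_relRan hdG'

/-- Witt's extension theorem, one step. -/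
lemma IsPartialIsometry.exists_lt [FiniteDimensional ℂ V]
    (hB : ∀ x y : V, B y x = starRingEnd ℂ (B x y)) (hT : NondegOn B T)
    (hG : IsPartialIsometry B G) (hGT : G ≤ T.prod T) (hne : relDom G ≠ T) :
    ∃ G', G < G' ∧ IsPartialIsometry B G' ∧ G' ≤ T.prod T := by
  obtain ⟨hGT₁, hGT₂⟩ := relDom_le_relRan_le hGT
  by_cases hd : NondegOn B (relDom G)
  · by_cases hnull : ∀ v ∈ T, (∀ e ∈ relDom G, B e v = 0) → B v v = 0
    · refine absurd ?_ hne
      have hrad : sesqRad B T = ⊥ := (Submodule.eq_bot_iff _).2 fun x hx => hT x hx.1 hx.2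
      simpa [hrad] using (hG.isCompl_sesqRad hB hGT₁ hd hnull).2
    · push Not at hnull
      obtain ⟨v, hvT, hv, hvv⟩ := hnull
      obtain ⟨G', h1, h2, h3, -⟩ := hG.exists_lt_of_anisotropic hB hGT hd le_rfl le_rfl hvT
        (fun a ha => hv _ ⟨a, ha, rfl⟩) hvv
      exact ⟨G', h1, h2, h3⟩
  · simp only [NondegOn] at hd
    push Not at hd
    obtain ⟨_, ⟨a, ha, rfl⟩, hr, hr0⟩ := hd
    rw [LinearMap.fst_apply] at hr hr0
    obtain ⟨v, hvT, hv⟩ : ∃ v ∈ T, B a.1 v ≠ 0 := by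
      by_contra! h
      exact hr0 (hT _ (hGT ha).1 fun y hy => by rw [hB, h y hy, map_zero])
    obtain ⟨w, hwT, hw⟩ := hG.exists_forall_apply_eq hB hGT₂ hT v
    have hra : ∀ b ∈ G, B b.2 a.2 = 0 := fun b hb => by
      rw [← hG.isometry b hb a ha]; exact hr _ ⟨b, hb, rfl⟩
    set c := B a.1 v with hc
    have hc' : starRingEnd ℂ c ≠ 0 := by simpa using hv
    set δ := B v v - B w w with hδ
    have hδ' : starRingEnd ℂ δ = δ := by rw [hδ, map_sub, ← hB, ← hB]
    have hwa : B w a.2 = starRingEnd ℂ c := by rw [hB a.2, hw a ha]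
    have hvd : v ∉ relDom G := by
      rintro ⟨b, hb, rfl⟩
      apply hv
      rw [hc, hB, hr _ ⟨b, hb, rfl⟩, map_zero]
    let w' := w + (δ / (2 * starRingEnd ℂ c)) • a.2
    have hw' : ∀ b ∈ G, B b.2 w' = B b.1 v := fun b hb => by
      simp [w', hw b hb, hra b hb]
    have hwr : w' ∉ relRan G := by
      rintro ⟨b, hb, hbw⟩
      have h1 := hw' a ha
      rw [← hbw, LinearMap.snd_apply, hB b.2, hra b hb, map_zero] at h1
      exact hv h1.symm
    have hww : B v v = B w' w' := by
      simp only [w', map_add, map_smul, map_smulₛₗ, LinearMap.add_apply, LinearMap.smul_apply,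
        smul_eq_mul, hra a ha, hw a ha, hwa, ← hc, map_div₀, map_mul, hδ', Complex.conj_conj,
        map_ofNat]
      field_simp
      rw [hδ]
      ring
    refine ⟨G ⊔ ℂ ∙ (v, w'), left_lt_sup.2 fun h => hvd ?_, hG.sup_span_singleton hB hvd hwr
      (fun b hb => (hw' b hb).symm) hww, sup_le hGT ?_⟩
    · exact ⟨_, h (Submodule.mem_span_singleton_self _), rfl⟩
    · simpa using ⟨hvT, add_mem hwT (T.smul_mem _ (hGT ha).2)⟩

/-- Witt's extension theorem. -/
lemma IsPartialIsometry.exists_ge [FiniteDimensional ℂ V]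
    (hB : ∀ x y : V, B y x = starRingEnd ℂ (B x y)) (hT : NondegOn B T)
    (hG : IsPartialIsometry B G) (hGT : G ≤ T.prod T) :
    ∃ G', G ≤ G' ∧ IsPartialIsometry B G' ∧ relDom G' = T ∧ relRan G' = T := by
  obtain ⟨G', ⟨hle, hG', hGT'⟩, hmax⟩ := WellFounded.has_min
    (wellFounded_gt (α := Submodule ℂ (V × V)))
    {G' | G ≤ G' ∧ IsPartialIsometry B G' ∧ G' ≤ T.prod T} ⟨G, le_rfl, hG, hGT⟩
  have hdom : relDom G' = T := by
    by_contra hne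
    obtain ⟨G'', hlt, h⟩ := hG'.exists_lt hB hT hGT' hne
    exact hmax G'' ⟨hle.trans hlt.le, h⟩ hlt
  refine ⟨G', hle, hG', hdom, Submodule.eq_of_le_of_finrank_eq (relDom_le_relRan_le hGT').2 ?_⟩
  rw [hG'.finrank_relRan, ← hG'.finrank_relDom, hdom]

/-- Totally isotropic subspaces of the same dimension are isometric. -/
lemma exists_isPartialIsometry_of_isotropic [FiniteDimensional ℂ V] {A A' : Submodule ℂ V}
    (hA : ∀ x ∈ A, ∀ y ∈ A, B x y = 0) (hA' : ∀ x ∈ A', ∀ y ∈ A', B x y = 0)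
    (h : finrank ℂ A = finrank ℂ A') :
    ∃ G, IsPartialIsometry B G ∧ relDom G = A ∧ relRan G = A' := by
  let e : A ≃ₗ[ℂ] A' := LinearEquiv.ofFinrankEq _ _ h
  refine ⟨LinearMap.range (A.subtype.prod (A'.subtype.comp (e : A →ₗ[ℂ] A'))),
    ⟨?_, ?_, ?_⟩, ?_, ?_⟩
  · rintro _ ⟨x, rfl⟩ _ ⟨y, rfl⟩
    exact (hA _ x.2 _ y.2).trans (hA' _ (e x).2 _ (e y).2).symm
  · rintro _ ⟨x, rfl⟩ hx
    have : x = 0 := Subtype.ext hx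
    simp [this]
  · rintro _ ⟨x, rfl⟩ hx
    have : e x = 0 := Subtype.ext hx
    have : x = 0 := by simpa using this
    simp [this]
  · rw [relDom, ← LinearMap.range_comp, LinearMap.fst_prod, Submodule.range_subtype]
  · rw [relRan, ← LinearMap.range_comp, LinearMap.snd_prod, LinearMap.range_comp,
      LinearEquiv.range, Submodule.map_top, Submodule.range_subtype]

/-- A partial isometry defined everywhere is the graph of a linear automorphism. -/
lemma IsPartialIsometry.exists_linearEquiv (hG : IsPartialIsometry B G) (hd : relDom G = ⊤)
    (hr : relRan G = ⊤) :
    ∃ g : V ≃ₗ[ℂ] V, (∀ x y, B (g x) (g y) = B x y) ∧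
      ∀ H ≤ G, (relDom H).map (g : V →ₗ[ℂ] V) = relRan H := by
  let p : G ≃ₗ[ℂ] V := LinearEquiv.ofBijective ((LinearMap.fst ℂ V V).comp G.subtype)
    ⟨(injective_iff_map_eq_zero _).2 fun a h =>
      Subtype.ext (Prod.ext h (hG.snd_eq_zero _ a.2 h)),
      LinearMap.range_eq_top.1 (by rw [LinearMap.range_comp, Submodule.range_subtype]; exact hd)⟩
  let q : G ≃ₗ[ℂ] V := LinearEquiv.ofBijective ((LinearMap.snd ℂ V V).comp G.subtype)
    ⟨(injective_iff_map_eq_zero _).2 fun a h =>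
      Subtype.ext (Prod.ext (hG.fst_eq_zero _ a.2 h) h),
      LinearMap.range_eq_top.1 (by rw [LinearMap.range_comp, Submodule.range_subtype]; exact hr)⟩
  have hpq : ∀ a (ha : a ∈ G), (p.symm.trans q) a.1 = a.2 := fun a ha => by
    have : p.symm a.1 = ⟨a, ha⟩ := p.symm_apply_eq.2 rfl
    rw [LinearEquiv.trans_apply, this]
    rfl
  refine ⟨p.symm.trans q, fun x y => ?_, fun H hH => ?_⟩
  · obtain ⟨a, rfl⟩ := p.surjective x
    obtain ⟨b, rfl⟩ := p.surjective y
    simp only [LinearEquiv.trans_apply, LinearEquiv.symm_apply_apply]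
    exact (hG.isometry a a.2 b b.2).symm
  · rw [relDom, ← Submodule.map_comp]
    exact SetLike.coe_injective (Set.image_congr fun a ha => hpq a (hH ha))

lemma relDom_map_prodMap (σ τ : V →ₗ[ℂ] V) :
    relDom (G.map (σ.prodMap τ)) = (relDom G).map σ := by
  rw [relDom, relDom, ← Submodule.map_comp, ← Submodule.map_comp]
  rfl

lemma relRan_map_prodMap (σ τ : V →ₗ[ℂ] V) :
    relRan (G.map (σ.prodMap τ)) = (relRan G).map τ := by
  rw [relRan, relRan, ← Submodule.map_comp, ← Submodule.map_comp]
  rfl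

lemma exists_disjoint_sup_eq {A R : Submodule ℂ V} (h : A ≤ R) :
    ∃ C, Disjoint C A ∧ C ⊔ A = R := by
  obtain ⟨C, hC⟩ := Submodule.exists_isCompl A
  refine ⟨C ⊓ R, hC.disjoint.symm.mono_left inf_le_left, ?_⟩
  rw [sup_comm, ← sup_inf_assoc_of_le _ h, hC.sup_eq_top, top_inf_eq]

/-- Subspaces with the same invariants admit an isometry between complements of any two subspaces
of their radicals of the same dimension. -/
lemma exists_isPartialIsometry_isCompl [FiniteDimensional ℂ V]
    (hB : ∀ x y : V, B y x = starRingEnd ℂ (B x y))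
    (hrad : finrank ℂ (sesqRad B T) = finrank ℂ (sesqRad B T'))
    (hpos : posIdxH B T = posIdxH B T') (hneg : negIdxH B T = negIdxH B T')
    {A A' : Submodule ℂ V} (hA : A ≤ sesqRad B T) (hA' : A' ≤ sesqRad B T')
    (hAA' : finrank ℂ A = finrank ℂ A') :
    ∃ G, IsPartialIsometry B G ∧ (Disjoint (relDom G) A ∧ relDom G ⊔ A = T) ∧
      (Disjoint (relRan G) A' ∧ relRan G ⊔ A' = T') := by
  obtain ⟨G, hG, ⟨hd, hd'⟩, hr, hr'⟩ := exists_isPartialIsometry_isCompl_sesqRad hB hpos hneg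
  obtain ⟨C, hC, hCA⟩ := exists_disjoint_sup_eq hA
  obtain ⟨C', hC', hCA'⟩ := exists_disjoint_sup_eq hA'
  have hCR : C ≤ sesqRad B T := hCA ▸ le_sup_left
  have hCR' : C' ≤ sesqRad B T' := hCA' ▸ le_sup_left
  have hrank : finrank ℂ C = finrank ℂ C' := by
    have h1 := Submodule.finrank_sup_add_finrank_inf_eq C A
    have h2 := Submodule.finrank_sup_add_finrank_inf_eq C' A'
    rw [hCA, hC.eq_bot, finrank_bot] at h1
    rw [hCA', hC'.eq_bot, finrank_bot] at h2
    omega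
  obtain ⟨H, hH, rfl, rfl⟩ := exists_isPartialIsometry_of_isotropic (B := B)
    (fun x hx y hy => (hCR hy).2 x (hCR hx).1) (fun x hx y hy => (hCR' hy).2 x (hCR' hx).1) hrank
  refine ⟨G ⊔ H, hG.sup hB hH (fun a ha b hb => ?_) (hd.mono_right hCR) (hr.mono_right hCR'), ?_⟩
  · have h1 : a.1 ∈ T := hd' ▸ Submodule.mem_sup_left ⟨a, ha, rfl⟩
    have h2 : a.2 ∈ T' := hr' ▸ Submodule.mem_sup_left ⟨a, ha, rfl⟩
    exact ((hCR ⟨b, hb, rfl⟩).2 _ h1).trans ((hCR' ⟨b, hb, rfl⟩).2 _ h2).symm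
  · simp only [relDom, relRan, Submodule.map_sup] at *
    rw [← hCA] at hd hd'
    rw [← hCA'] at hr hr'
    exact ⟨⟨hC.disjoint_sup_left_of_disjoint_sup_right hd, by rw [sup_assoc, hd']⟩,
      hC'.disjoint_sup_left_of_disjoint_sup_right hr, by rw [sup_assoc, hr']⟩

lemma mem_projAlong {C A S : Submodule ℂ V} {p : V} :
    p ∈ projAlong C A S ↔ p ∈ A ∧ ∃ s ∈ S, s - p ∈ C := by
  rw [projAlong, Submodule.mem_inf, and_comm, Submodule.mem_sup]
  refine and_congr_right fun _ => exists_congr fun s => and_congr_right fun _ => ?_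
  constructor
  · rintro ⟨z, hz, rfl⟩
    simpa using hz
  · intro h
    exact ⟨p - s, by simpa using neg_mem h, by simp⟩

/-- A linear section of the projection of `S`. -/
lemma exists_section_projAlong (C A S : Submodule ℂ V) :
    ∃ σ : V →ₗ[ℂ] V, ∀ p ∈ projAlong C A S, σ p ∈ S ∧ σ p - p ∈ C := by
  let f : S →ₗ[ℂ] V ⧸ C := C.mkQ.comp S.subtype
  obtain ⟨h, hh⟩ := f.rangeRestrict.exists_rightInverse_of_surjective f.range_rangeRestrict
  obtain ⟨k, hk⟩ := LinearMap.exists_extend h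
  refine ⟨S.subtype ∘ₗ k ∘ₗ C.mkQ, fun p hp => ⟨(k (C.mkQ p)).2, ?_⟩⟩
  obtain ⟨-, s, hs, hsp⟩ := mem_projAlong.1 hp
  have hps : C.mkQ p = f ⟨s, hs⟩ := ((Submodule.Quotient.eq C).2 hsp).symm
  have h1 : k (C.mkQ p) = h (f.rangeRestrict ⟨s, hs⟩) := by
    rw [hps, ← hk]
    rfl
  have h2 : f (k (C.mkQ p)) = C.mkQ p := by
    rw [h1, hps]
    exact congrArg Subtype.val (LinearMap.congr_fun hh (f.rangeRestrict ⟨s, hs⟩))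
  exact (Submodule.Quotient.eq C).1 h2

variable {U W S D : Submodule ℂ V}

lemma inf_le_sesqRad_projAlong (hB : ∀ x y : V, B y x = starRingEnd ℂ (B x y))
    (horth : ∀ u ∈ U, ∀ w ∈ W, B u w = 0) (hS : ∀ s ∈ S, ∀ s' ∈ S, B s s' = 0) :
    S ⊓ U ≤ sesqRad B (projAlong W U S) := by
  rintro u ⟨huS, huU⟩
  refine ⟨mem_projAlong.2 ⟨huU, u, huS, by simp⟩, fun t ht => ?_⟩
  obtain ⟨-, s, hs, hst⟩ := mem_projAlong.1 ht
  have h := horth u huU _ hst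
  rw [map_sub, hS u huS s hs, zero_sub, neg_eq_zero] at h
  rw [hB u t, h, map_zero]

variable {σ : V →ₗ[ℂ] V}

lemma eq_zero_of_section_sub_mem (hσ : ∀ p ∈ projAlong W U S, σ p ∈ S ∧ σ p - p ∈ W)
    (hD : Disjoint D (S ⊓ U)) (hDS : D ⊔ S ⊓ U = projAlong W U S) {p : V} (hp : p ∈ D)
    (h : σ p - p ∈ S) : p = 0 := by
  have hpP : p ∈ projAlong W U S := hDS ▸ Submodule.mem_sup_left hp
  refine Submodule.disjoint_def.1 hD p hp ⟨?_, (mem_projAlong.1 hpP).1⟩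
  simpa using sub_mem (hσ p hpP).1 h

lemma disjoint_map_section_sub_id (hσ : ∀ p ∈ projAlong W U S, σ p ∈ S ∧ σ p - p ∈ W)
    (hD : Disjoint D (S ⊓ U)) (hDS : D ⊔ S ⊓ U = projAlong W U S) :
    Disjoint (D.map (σ - LinearMap.id)) (S ⊓ W) := by
  rw [Submodule.disjoint_def]
  rintro _ ⟨p, hp, rfl⟩ h
  rw [eq_zero_of_section_sub_mem hσ hD hDS hp h.1, map_zero]

lemma eq_sup_map_section (hUWtop : U ⊔ W = ⊤)
    (hσ : ∀ p ∈ projAlong W U S, σ p ∈ S ∧ σ p - p ∈ W)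
    (hDS : D ⊔ S ⊓ U = projAlong W U S) : S ⊓ U ⊔ S ⊓ W ⊔ D.map σ = S := by
  refine le_antisymm (sup_le (sup_le inf_le_left inf_le_left) ?_) fun s hs => ?_
  · rintro _ ⟨p, hp, rfl⟩
    exact (hσ p (hDS ▸ Submodule.mem_sup_left hp)).1
  · obtain ⟨u, hu, w, hw, rfl⟩ := Submodule.mem_sup.1 (hUWtop ▸ Submodule.mem_top : s ∈ U ⊔ W)
    have huP : u ∈ D ⊔ S ⊓ U := hDS ▸ mem_projAlong.2 ⟨hu, _, hs, by simpa using hw⟩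
    obtain ⟨p, hp, a, ha, rfl⟩ := Submodule.mem_sup.1 huP
    obtain ⟨hpS, hpW⟩ := hσ p (hDS ▸ Submodule.mem_sup_left hp)
    have hb : w - (σ p - p) ∈ S ⊓ W := by
      refine ⟨?_, sub_mem hw hpW⟩
      have e : w - (σ p - p) = p + a + w - a - σ p := by abel
      exact e ▸ sub_mem (sub_mem hs ha.1) hpS
    have e : p + a + w = a + (w - (σ p - p)) + σ p := by abel
    rw [e]
    exact Submodule.add_mem_sup (Submodule.add_mem_sup ha hb) ⟨p, hp, rfl⟩

lemma nondegOn_of_orthogonal (hB : ∀ x y : V, B y x = starRingEnd ℂ (B x y))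
    (hBnd : ∀ x : V, (∀ y : V, B x y = 0) → x = 0) (hUWtop : U ⊔ W = ⊤)
    (horth : ∀ u ∈ U, ∀ w ∈ W, B u w = 0) : NondegOn B U := by
  refine fun x hx h => hBnd x fun y => ?_
  obtain ⟨u, hu, w, hw, rfl⟩ := Submodule.mem_sup.1 (hUWtop ▸ Submodule.mem_top : y ∈ U ⊔ W)
  rw [map_add, horth x hx w hw, hB u x, h u hu, map_zero, add_zero]

lemma apply_section (hB : ∀ x y : V, B y x = starRingEnd ℂ (B x y))
    (horth : ∀ u ∈ U, ∀ w ∈ W, B u w = 0)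
    (hσ : ∀ p ∈ projAlong W U S, σ p ∈ S ∧ σ p - p ∈ W)
    {p q : V} (hp : p ∈ projAlong W U S) (hq : q ∈ projAlong W U S) :
    B (σ p) (σ q) = B p q + B (σ p - p) (σ q - q) := by
  have h1 := horth p (mem_projAlong.1 hp).1 _ (hσ q hq).2
  have h2 := horth q (mem_projAlong.1 hq).1 _ (hσ p hp).2
  have h3 : B (σ p - p) q = 0 := by rw [hB q, h2, map_zero]
  simp only [map_sub, LinearMap.sub_apply] at h1 h3 ⊢
  linear_combination h1 + h3

/-- Transport of a partial isometry of `U` to `W` along sections of isotropic subspaces. -/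
lemma IsPartialIsometry.map_section_sub_id {S' : Submodule ℂ V} {τ : V →ₗ[ℂ] V}
    (hB : ∀ x y : V, B y x = starRingEnd ℂ (B x y))
    (horth : ∀ u ∈ U, ∀ w ∈ W, B u w = 0)
    (hS : ∀ s ∈ S, ∀ s' ∈ S, B s s' = 0) (hS' : ∀ s ∈ S', ∀ s' ∈ S', B s s' = 0)
    (hσ : ∀ p ∈ projAlong W U S, σ p ∈ S ∧ σ p - p ∈ W)
    (hτ : ∀ p ∈ projAlong W U S', τ p ∈ S' ∧ τ p - p ∈ W) (hG : IsPartialIsometry B G)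
    (hd : Disjoint (relDom G) (S ⊓ U)) (hd' : relDom G ⊔ S ⊓ U = projAlong W U S)
    (hr : Disjoint (relRan G) (S' ⊓ U)) (hr' : relRan G ⊔ S' ⊓ U = projAlong W U S') :
    IsPartialIsometry B (G.map ((σ - LinearMap.id).prodMap (τ - LinearMap.id))) := by
  have hP : ∀ a ∈ G, a.1 ∈ projAlong W U S := fun a ha =>
    hd' ▸ Submodule.mem_sup_left ⟨a, ha, rfl⟩
  have hP' : ∀ a ∈ G, a.2 ∈ projAlong W U S' := fun a ha =>
    hr' ▸ Submodule.mem_sup_left ⟨a, ha, rfl⟩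
  refine ⟨?_, ?_, ?_⟩
  · rintro _ ⟨a, ha, rfl⟩ _ ⟨b, hb, rfl⟩
    have h1 := apply_section hB horth hσ (hP a ha) (hP b hb)
    have h2 := apply_section hB horth hτ (hP' a ha) (hP' b hb)
    rw [hS _ (hσ _ (hP a ha)).1 _ (hσ _ (hP b hb)).1] at h1
    rw [hS' _ (hτ _ (hP' a ha)).1 _ (hτ _ (hP' b hb)).1, ← hG.isometry a ha b hb] at h2
    exact add_left_cancel (h1.symm.trans h2)
  · rintro _ ⟨a, ha, rfl⟩ h
    have h1 := eq_zero_of_section_sub_mem hσ hd hd' ⟨a, ha, rfl⟩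
      ((show σ a.1 - a.1 = 0 from h) ▸ zero_mem _)
    simp [hG.snd_eq_zero a ha h1]
  · rintro _ ⟨a, ha, rfl⟩ h
    have h1 := eq_zero_of_section_sub_mem hτ hr hr' ⟨a, ha, rfl⟩
      ((show τ a.2 - a.2 = 0 from h) ▸ zero_mem _)
    simp [hG.fst_eq_zero a ha h1]

/-- Products of `S ⊓ W` with the `W`-components of elements of `S`. -/
lemma apply_section_sub_eq_zero
    (horth : ∀ u ∈ U, ∀ w ∈ W, B u w = 0) (hS : ∀ s ∈ S, ∀ s' ∈ S, B s s' = 0)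
    (hσ : ∀ p ∈ projAlong W U S, σ p ∈ S ∧ σ p - p ∈ W) {p w : V}
    (hp : p ∈ projAlong W U S) (hw : w ∈ S ⊓ W) : B (σ p - p) w = 0 := by
  rw [map_sub, LinearMap.sub_apply, hS _ (hσ p hp).1 w hw.1,
    horth p (mem_projAlong.1 hp).1 w hw.2, sub_zero]

end PartialIsometry

/-- two isotropic subspaces with the same invariants are in the same
orbit of the symmetric subgroup of the unitary group. -/
theorem stmt_7 (V : Type*) [AddCommGroup V] [Module ℂ V] [FiniteDimensional ℂ V]
    (B : V →ₛₗ[starRingEnd ℂ] V →ₗ[ℂ] ℂ)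
    (hBherm : ∀ x y : V, B y x = starRingEnd ℂ (B x y))
    (hBnd : ∀ x : V, (∀ y : V, B x y = 0) → x = 0)
    (U W : Submodule ℂ V) (hUW : U ⊓ W = ⊥) (hUWtop : U ⊔ W = ⊤)
    (horth : ∀ u ∈ U, ∀ w ∈ W, B u w = 0)
    (S S' : Submodule ℂ V)
    (hS : ∀ s ∈ S, ∀ s' ∈ S, B s s' = 0)
    (hS' : ∀ s ∈ S', ∀ s' ∈ S', B s s' = 0)
    (h1 : finrank ℂ (S ⊓ U : Submodule ℂ V) = finrank ℂ (S' ⊓ U : Submodule ℂ V))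
    (h2 : finrank ℂ (S ⊓ W : Submodule ℂ V) = finrank ℂ (S' ⊓ W : Submodule ℂ V))
    (h3 : finrank ℂ (sesqRad B (projAlong W U S)) = finrank ℂ (sesqRad B (projAlong W U S')))
    (h4 : posIdxH B (projAlong W U S) = posIdxH B (projAlong W U S'))
    (h5 : negIdxH B (projAlong W U S) = negIdxH B (projAlong W U S')) :
    ∃ g : V ≃ₗ[ℂ] V, (∀ x y : V, B (g x) (g y) = B x y) ∧
      Submodule.map (g : V →ₗ[ℂ] V) U = U ∧
      Submodule.map (g : V →ₗ[ℂ] V) W = W ∧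
      Submodule.map (g : V →ₗ[ℂ] V) S = S' := by
  have horth' : ∀ w ∈ W, ∀ u ∈ U, B w u = 0 := fun w hw u hu => by
    rw [hBherm u w, horth u hu w hw, map_zero]
  have hAR := inf_le_sesqRad_projAlong hBherm horth hS
  have hAR' := inf_le_sesqRad_projAlong hBherm horth hS'
  obtain ⟨G, hG, ⟨hd, hd'⟩, hr, hr'⟩ :=
    exists_isPartialIsometry_isCompl hBherm h3 h4 h5 hAR hAR' h1
  have hP : ∀ a ∈ G, a.1 ∈ projAlong W U S := fun a ha =>
    hd' ▸ Submodule.mem_sup_left ⟨a, ha, rfl⟩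
  have hP' : ∀ a ∈ G, a.2 ∈ projAlong W U S' := fun a ha =>
    hr' ▸ Submodule.mem_sup_left ⟨a, ha, rfl⟩
  obtain ⟨σ, hσ⟩ := exists_section_projAlong W U S
  obtain ⟨τ, hτ⟩ := exists_section_projAlong W U S'
  obtain ⟨HU, hHU, hHUd, hHUr⟩ := exists_isPartialIsometry_of_isotropic (B := B) (A := S ⊓ U) (A' := S' ⊓ U)
    (fun x hx y hy => hS x hx.1 y hy.1) (fun x hx y hy => hS' x hx.1 y hy.1) h1
  obtain ⟨HW, hHW, hHWd, hHWr⟩ := exists_isPartialIsometry_of_isotropic (B := B) (A := S ⊓ W) (A' := S' ⊓ W)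
    (fun x hx y hy => hS x hx.1 y hy.1) (fun x hx y hy => hS' x hx.1 y hy.1) h2
  have hHU₁ : ∀ a ∈ HU, a.1 ∈ S ⊓ U := fun a ha => hHUd ▸ ⟨a, ha, rfl⟩
  have hHU₂ : ∀ a ∈ HU, a.2 ∈ S' ⊓ U := fun a ha => hHUr ▸ ⟨a, ha, rfl⟩
  have hHW₁ : ∀ a ∈ HW, a.1 ∈ S ⊓ W := fun a ha => hHWd ▸ ⟨a, ha, rfl⟩
  have hHW₂ : ∀ a ∈ HW, a.2 ∈ S' ⊓ W := fun a ha => hHWr ▸ ⟨a, ha, rfl⟩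
  have hGU : IsPartialIsometry B (G ⊔ HU) := by
    refine hG.sup hBherm hHU (fun a ha b hb => ?_) (by rwa [hHUd]) (by rwa [hHUr])
    rw [(hAR (hHU₁ b hb)).2 _ (hP a ha), (hAR' (hHU₂ b hb)).2 _ (hP' a ha)]
  let K := G.map ((σ - LinearMap.id).prodMap (τ - LinearMap.id))
  have hGW : IsPartialIsometry B (K ⊔ HW) := by
    refine (hG.map_section_sub_id hBherm horth hS hS' hσ hτ hd hd' hr hr').sup hBherm hHW ?_ ?_ ?_
    · rintro _ ⟨a, ha, rfl⟩ b hb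
      exact (apply_section_sub_eq_zero horth hS hσ (hP a ha) (hHW₁ b hb)).trans
        (apply_section_sub_eq_zero horth hS' hτ (hP' a ha) (hHW₂ b hb)).symm
    · rw [relDom_map_prodMap, hHWd]
      exact disjoint_map_section_sub_id hσ hd hd'
    · rw [relRan_map_prodMap, hHWr]
      exact disjoint_map_section_sub_id hτ hr hr'
  obtain ⟨EU, hEU, hEU', hEUd, hEUr⟩ := hGU.exists_ge hBherm
    (nondegOn_of_orthogonal hBherm hBnd hUWtop horth) <|
    sup_le (fun a ha => ⟨(mem_projAlong.1 (hP a ha)).1, (mem_projAlong.1 (hP' a ha)).1⟩)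
      fun a ha => ⟨(hHU₁ a ha).2, (hHU₂ a ha).2⟩
  obtain ⟨EW, hEW, hEW', hEWd, hEWr⟩ := hGW.exists_ge hBherm
    (nondegOn_of_orthogonal hBherm hBnd (sup_comm U W ▸ hUWtop) horth') <| by
    refine sup_le ?_ fun a ha => ⟨(hHW₁ a ha).2, (hHW₂ a ha).2⟩
    rintro _ ⟨a, ha, rfl⟩
    exact ⟨(hσ _ (hP a ha)).2, (hτ _ (hP' a ha)).2⟩
  have hE : IsPartialIsometry B (EU ⊔ EW) := by
    refine hEU'.sup hBherm hEW' (fun a ha b hb => ?_) ?_ ?_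
    · rw [horth _ (hEUd ▸ ⟨a, ha, rfl⟩) _ (hEWd ▸ ⟨b, hb, rfl⟩),
        horth _ (hEUr ▸ ⟨a, ha, rfl⟩) _ (hEWr ▸ ⟨b, hb, rfl⟩)]
    · rw [hEUd, hEWd]
      exact disjoint_iff.2 hUW
    · rw [hEUr, hEWr]
      exact disjoint_iff.2 hUW
  obtain ⟨g, hg, hgmap⟩ := hE.exists_linearEquiv
    ((Submodule.map_sup _ _ _).trans ((congrArg₂ _ hEUd hEWd).trans hUWtop))
    ((Submodule.map_sup _ _ _).trans ((congrArg₂ _ hEUr hEWr).trans hUWtop))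
  refine ⟨g, hg, ?_, ?_, ?_⟩
  · simpa only [hEUd, hEUr] using hgmap EU le_sup_left
  · simpa only [hEWd, hEWr] using hgmap EW le_sup_right
  · have e₁ := hgmap HU ((le_sup_right.trans hEU).trans le_sup_left)
    have e₂ := hgmap HW ((le_sup_right.trans hEW).trans le_sup_right)
    have e₃ := hgmap (G.map (σ.prodMap τ)) <| by
      rintro _ ⟨a, ha, rfl⟩
      have e : σ.prodMap τ a = a + (σ - LinearMap.id).prodMap (τ - LinearMap.id) a := by
        ext <;> simp
      rw [e]
      exact Submodule.add_mem_sup (hEU (Submodule.mem_sup_left ha))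
        (hEW (Submodule.mem_sup_left ⟨a, ha, rfl⟩))
    rw [hHUd, hHUr] at e₁
    rw [hHWd, hHWr] at e₂
    rw [relDom_map_prodMap, relRan_map_prodMap] at e₃
    rw [← eq_sup_map_section hUWtop hσ hd', Submodule.map_sup, Submodule.map_sup, e₁, e₂, e₃,
      eq_sup_map_section hUWtop hτ hr']
end

section
/- posIdx(proj_U S) = negIdx(proj_W S), negIdx(proj_U S) = posIdx(proj_W S), and dim Rad(proj_U S) − dim(S ∩ U) = dim Rad(proj_W S) − dim(S ∩ W). -/
open Module
open scoped ComplexOrder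

/-- The projection of a submodule along a complement is its image under the projection map. -/
theorem projAlong_eq_map_projection {k V : Type*} [Field k] [AddCommGroup V] [Module k V]
    {A C : Submodule k V} (h : IsCompl A C) (S : Submodule k V) :
    projAlong C A S = S.map (A.projection C h) := by
  ext x
  simp only [projAlong, Submodule.mem_inf, Submodule.mem_sup, Submodule.mem_map]
  constructor
  · rintro ⟨⟨s, hs, c, hc, rfl⟩, hx⟩
    refine ⟨s, hs, ?_⟩
    have h1 : A.projection C h (s + c) = s + c :=
      Submodule.projection_apply_left h ⟨s + c, hx⟩
    have h2 : A.projection C h c = 0 :=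
      (Submodule.projection_apply_eq_zero_iff h).2 hc
    rwa [map_add, h2, add_zero] at h1
  · rintro ⟨s, hs, rfl⟩
    refine ⟨⟨s, hs, -C.projection A h.symm s, ?_, ?_⟩, ?_⟩
    · exact neg_mem (Submodule.projection_apply_mem h.symm s)
    · rw [← sub_eq_add_neg, sub_eq_iff_eq_add]
      exact (Submodule.projection_add_projection_eq_self h s).symm
    · exact Submodule.projection_apply_mem h s

section

variable {V : Type*} [AddCommGroup V] [Module ℂ V] {B : V →ₛₗ[starRingEnd ℂ] V →ₗ[ℂ] ℂ}
  {p q : V →ₗ[ℂ] V} {S : Submodule ℂ V}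

/-- If the forms induced on `S` by `p` and `q` are opposite, then a definite subspace of the image
of `p` yields a subspace of the image of `q` of the same dimension and the opposite sign. -/
theorem exists_definite_of_form_eq_neg
    (hpq : ∀ x ∈ S, ∀ y ∈ S, B (p x) (p y) = -B (q x) (q y))
    {P Q : ℂ → Prop} (hP : ¬ P 0) (hPQ : ∀ z, P (-z) → Q z) {n : ℕ}
    (h : ∃ T ≤ S.map p, (∀ v ∈ T, v ≠ 0 → P (B v v)) ∧ finrank ℂ T = n) :
    ∃ T ≤ S.map q, (∀ v ∈ T, v ≠ 0 → Q (B v v)) ∧ finrank ℂ T = n := by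
  obtain ⟨T, hT, hdef, rfl⟩ := h
  obtain ⟨g, hg⟩ := (p.submoduleMap S).exists_rightInverse_of_surjective
    (LinearMap.range_eq_top.2 (p.submoduleMap_surjective S))
  have hg' (y : S.map p) : p (g y) = y := congrArg Subtype.val (LinearMap.congr_fun hg y)
  let f : T →ₗ[ℂ] V := q ∘ₗ S.subtype ∘ₗ g ∘ₗ Submodule.inclusion hT
  have hf (t : T) : B t t = -B (f t) (f t) := by
    have := hpq _ (g (Submodule.inclusion hT t)).2 _ (g (Submodule.inclusion hT t)).2
    rwa [hg'] at this
  have hinj : Function.Injective f := by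
    rw [← LinearMap.ker_eq_bot, LinearMap.ker_eq_bot']
    intro t ht
    by_contra h0
    refine hP ?_
    have h1 := hdef t t.2 (by simpa using h0)
    rwa [hf, ht, map_zero, neg_zero] at h1
  refine ⟨LinearMap.range f, ?_, ?_, LinearMap.finrank_range_of_inj hinj⟩
  · rintro _ ⟨t, rfl⟩
    exact Submodule.mem_map_of_mem (g _).2
  · rintro _ ⟨t, rfl⟩ h0
    refine hPQ _ ?_
    rw [← hf]
    refine hdef t t.2 fun ht => h0 ?_
    rw [Submodule.coe_eq_zero.1 ht, map_zero]

theorem posIdxH_map_eq_negIdxH_map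
    (hpq : ∀ x ∈ S, ∀ y ∈ S, B (p x) (p y) = -B (q x) (q y)) :
    posIdxH B (S.map p) = negIdxH B (S.map q) := by
  have hqp : ∀ x ∈ S, ∀ y ∈ S, B (q x) (q y) = -B (p x) (p y) := fun x hx y hy => by
    rw [hpq x hx y hy, neg_neg]
  refine congrArg sSup (Set.ext fun n => ⟨fun h => ?_, fun h => ?_⟩)
  · exact exists_definite_of_form_eq_neg (P := fun z => 0 < z) (Q := fun z => z < 0) hpq
      (lt_irrefl _) (fun z hz => neg_pos.1 hz) h
  · exact exists_definite_of_form_eq_neg (P := fun z => z < 0) (Q := fun z => 0 < z) hqp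
      (lt_irrefl _) (fun z hz => neg_lt_zero.1 hz) h

theorem mem_sesqRad_map_iff {x : V} (hx : x ∈ S) :
    p x ∈ sesqRad B (S.map p) ↔ ∀ y ∈ S, B (p y) (p x) = 0 := by
  refine ⟨fun h y hy => h.2 _ (Submodule.mem_map_of_mem hy), fun h => ?_⟩
  refine ⟨Submodule.mem_map_of_mem hx, ?_⟩
  rintro _ ⟨y, hy, rfl⟩
  exact h y hy

/-- Rank-nullity for `p` on the preimage in `S` of a subspace `T` of the image of `S`. -/
theorem finrank_add_finrank_inf_ker [FiniteDimensional ℂ V] {T : Submodule ℂ V}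
    (hT : T ≤ S.map p) :
    finrank ℂ T + finrank ℂ (S ⊓ LinearMap.ker p : Submodule ℂ V) =
      finrank ℂ (S ⊓ T.comap p : Submodule ℂ V) := by
  have hmap : (S ⊓ T.comap p).map p = T := by
    rw [← Submodule.map_inf_eq_map_inf_comap, inf_eq_right.2 hT]
  have hker : (S ⊓ T.comap p) ⊓ LinearMap.ker p = S ⊓ LinearMap.ker p := by
    rw [inf_assoc, inf_eq_right.2 (LinearMap.ker_le_comap p)]
  have h := LinearMap.finrank_range_add_finrank_ker (p.domRestrict (S ⊓ T.comap p))
  rw [LinearMap.range_domRestrict, hmap, LinearMap.ker_domRestrict] at h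
  rw [← hker, ← h, ← Submodule.map_comap_subtype, Submodule.finrank_map_subtype_eq]

theorem finrank_sesqRad_map_add [FiniteDimensional ℂ V]
    (hpq : ∀ x ∈ S, ∀ y ∈ S, B (p x) (p y) = -B (q x) (q y)) :
    finrank ℂ (sesqRad B (S.map p)) + finrank ℂ (S ⊓ LinearMap.ker p : Submodule ℂ V) =
      finrank ℂ (sesqRad B (S.map q)) + finrank ℂ (S ⊓ LinearMap.ker q : Submodule ℂ V) := by
  have hle (r : V →ₗ[ℂ] V) : sesqRad B (S.map r) ≤ S.map r := inf_le_left
  rw [finrank_add_finrank_inf_ker (hle p), finrank_add_finrank_inf_ker (hle q)]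
  suffices h : S ⊓ (sesqRad B (S.map p)).comap p = S ⊓ (sesqRad B (S.map q)).comap q by rw [h]
  ext x
  simp only [Submodule.mem_inf, Submodule.mem_comap]
  refine and_congr_right fun hx => ?_
  rw [mem_sesqRad_map_iff hx, mem_sesqRad_map_iff hx]
  refine forall₂_congr fun y hy => ?_
  rw [hpq y hy x hx, neg_eq_zero]

end

/-- `posIdx(proj_U S) = negIdx(proj_W S)`,
`negIdx(proj_U S) = posIdx(proj_W S)`, and
`dim Rad(proj_U S) − dim(S ∩ U) = dim Rad(proj_W S) − dim(S ∩ W)`. -/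
theorem stmt_9 (V : Type*) [AddCommGroup V] [Module ℂ V] [FiniteDimensional ℂ V]
    (B : V →ₛₗ[starRingEnd ℂ] V →ₗ[ℂ] ℂ)
    (hBherm : ∀ x y : V, B y x = starRingEnd ℂ (B x y))
    (hBnd : ∀ x : V, (∀ y : V, B x y = 0) → x = 0)
    (U W : Submodule ℂ V) (hUW : U ⊓ W = ⊥) (hUWtop : U ⊔ W = ⊤)
    (horth : ∀ u ∈ U, ∀ w ∈ W, B u w = 0)
    (S : Submodule ℂ V) (hS : ∀ s ∈ S, ∀ s' ∈ S, B s s' = 0) :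
    posIdxH B (projAlong W U S) = negIdxH B (projAlong U W S) ∧
    negIdxH B (projAlong W U S) = posIdxH B (projAlong U W S) ∧
    (finrank ℂ (sesqRad B (projAlong W U S)) : ℤ) - finrank ℂ (S ⊓ U : Submodule ℂ V)
      = (finrank ℂ (sesqRad B (projAlong U W S)) : ℤ) - finrank ℂ (S ⊓ W : Submodule ℂ V) := by
  have hc : IsCompl U W := ⟨disjoint_iff.2 hUW, codisjoint_iff.2 hUWtop⟩
  have horth' : ∀ w ∈ W, ∀ u ∈ U, B w u = 0 := fun w hw u hu => by
    rw [hBherm u w, horth u hu w hw, map_zero]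
  set p := U.projection W hc with hp
  set q := W.projection U hc.symm with hq
  have hpU (x : V) : p x ∈ U := Submodule.projection_apply_mem hc x
  have hqW (x : V) : q x ∈ W := Submodule.projection_apply_mem hc.symm x
  have hsum (x : V) : p x + q x = x := Submodule.projection_add_projection_eq_self hc x
  have hpq : ∀ x ∈ S, ∀ y ∈ S, B (p x) (p y) = -B (q x) (q y) := by
    intro x hx y hy
    have h := hS x hx y hy
    rw [← hsum x, ← hsum y, LinearMap.map_add₂, map_add, map_add,
      horth _ (hpU x) _ (hqW y), horth' _ (hqW x) _ (hpU y), add_zero, zero_add] at h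
    exact eq_neg_of_add_eq_zero_left h
  have hqp : ∀ x ∈ S, ∀ y ∈ S, B (q x) (q y) = -B (p x) (p y) := fun x hx y hy => by
    rw [hpq x hx y hy, neg_neg]
  have hrad := finrank_sesqRad_map_add hpq
  rw [hp, hq, Submodule.ker_projection, Submodule.ker_projection, ← hp, ← hq]
    at hrad
  rw [projAlong_eq_map_projection hc, projAlong_eq_map_projection hc.symm, ← hp, ← hq]
  refine ⟨posIdxH_map_eq_negIdxH_map hpq, (posIdxH_map_eq_negIdxH_map hqp).symm, ?_⟩
  omega
end
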